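/- arXiv:2110.07267 — 2 statements merged into one kernel-verified Lean document; each statement's English description precedes it below -/
import Mathlib

section
/- (Constantin–E–Titi-type commutator estimate, space-time version.) Let d≥2, 0<α_i≤β_i for i=1,2, and 1≤p,q,p₁,q₁,p₂,q₂≤∞ with 1/p = 1/p₁ + 1/p₂ and 1/q = 1/q₁ + 1/q₂. Then there is a constant C such that for every f ∈ B^{β₁}_{p₁,∞}((0,T);B^{α₁}_{q₁,∞}(𝕋^d)), every g ∈ B^{β₂}_{p₂,∞}((0,T);B^{α₂}_{q₂,∞}(𝕋^d)) and every ε>0, ‖(fg)^ε − f^ε g^ε‖_{L^p(0,T;L^q(𝕋^d))} ≤ C ε^{α₁+α₂} ‖f‖_{B^{β₁}_{p₁,∞}((0,T);B^{α₁}_{q₁,∞}(𝕋^d))} ‖g‖_{B^{β₂}_{p₂,∞}((0,T);B^{α₂}_{q₂,∞}(𝕋^d))}, where f^ε, g^ε, (fg)^ε denote space-time mollifications and the left-hand norm is taken over the set where they are defined. -/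
open MeasureTheory ENNReal

noncomputable section

namespace CompressibleEuler

variable {d : ℕ} {E : Type*} [NormedAddCommGroup E]

/-- Euclidean norm on `Fin d → ℝ`. -/
def euNorm (x : Fin d → ℝ) : ℝ := Real.sqrt (∑ i, x i ^ 2)

/-- The fundamental domain `[0,1)^d` of the torus `𝕋^d = [0,1]^d`. -/
def unitCube (d : ℕ) : Set (Fin d → ℝ) := Set.univ.pi fun _ => Set.Ico (0 : ℝ) 1

/-- Lebesgue measure on the torus `𝕋^d`, realized on the fundamental domain. -/
def cubeVol (d : ℕ) : Measure (Fin d → ℝ) := volume.restrict (unitCube d)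

/-- Product measure on `(0,T) × 𝕋^d`. -/
def spaceTime (d : ℕ) (T : ℝ) : Measure (ℝ × (Fin d → ℝ)) :=
  (volume.restrict (Set.Ioo 0 T)).prod (cubeVol d)

/-- `ℤ^d`-periodicity of a function on `ℝ^d` (i.e. a function on the torus `𝕋^d`). -/
def SpacePeriodic (f : (Fin d → ℝ) → E) : Prop :=
  ∀ (x : Fin d → ℝ) (n : Fin d → ℤ), f (x + fun i => (n i : ℝ)) = f x

/-- The `L^p` norm in time (exponent possibly `∞`) of an `ℝ≥0∞`-valued quantity,
over a time set `s`. -/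
def timeLpOn (s : Set ℝ) (p : ℝ≥0∞) (F : ℝ → ℝ≥0∞) : ℝ≥0∞ :=
  if p = ∞ then essSup F (volume.restrict s)
  else (∫⁻ t in s, F t ^ p.toReal) ^ (1 / p.toReal)

/-- The `L^p(0,T;L^q(𝕋^d))` norm. -/
def LpLqNorm (T : ℝ) (p q : ℝ≥0∞) (u : ℝ → (Fin d → ℝ) → E) : ℝ≥0∞ :=
  timeLpOn (Set.Ioo 0 T) p fun t => eLpNorm (u t) q (cubeVol d)

/-- `u ∈ L^p(0,T;L^q(𝕋^d))`. -/
def MemLpLq (T : ℝ) (p q : ℝ≥0∞) (u : ℝ → (Fin d → ℝ) → E) : Prop :=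
  LpLqNorm T p q u < ∞

/-- The homogeneous Besov seminorm `‖·‖_{Ḃ^α_{q,∞}(𝕋^d)}`. -/
def besovSeminorm (α : ℝ) (q : ℝ≥0∞) (f : (Fin d → ℝ) → E) : ℝ≥0∞ :=
  ⨆ (y : Fin d → ℝ) (_ : y ≠ 0),
    eLpNorm (fun x => f (x - y) - f x) q (cubeVol d) / ENNReal.ofReal (euNorm y ^ α)

/-- The Besov norm of `B^α_{q,∞}(𝕋^d)`. -/
def besovNorm (α : ℝ) (q : ℝ≥0∞) (f : (Fin d → ℝ) → E) : ℝ≥0∞ :=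
  eLpNorm f q (cubeVol d) + besovSeminorm α q f

/-- The `L^p(0,T;B^α_{q,∞}(𝕋^d))` norm. -/
def LpBesovNorm (T : ℝ) (p : ℝ≥0∞) (α : ℝ) (q : ℝ≥0∞) (u : ℝ → (Fin d → ℝ) → E) : ℝ≥0∞ :=
  timeLpOn (Set.Ioo 0 T) p fun t => besovNorm α q (u t)

/-- `u ∈ L^p(0,T;B^α_{q,∞}(𝕋^d))`. -/
def MemLpBesov (T : ℝ) (p : ℝ≥0∞) (α : ℝ) (q : ℝ≥0∞) (u : ℝ → (Fin d → ℝ) → E) : Prop :=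
  LpBesovNorm T p α q u < ∞

/-- The norm of the space-time Besov space `B^β_{p,∞}((0,T);B^α_{q,∞}(𝕋^d))`:
the `L^p(0,T;B^α_{q,∞})` norm plus the time-translation seminorm
`sup_{τ≠0} |τ|^{-β} ‖u(·-τ)-u(·)‖_{L^p(B^α_{q,∞})}`, the inner norm being taken
over the times where both terms are defined. -/
def besovBesovNorm (T β : ℝ) (p : ℝ≥0∞) (α : ℝ) (q : ℝ≥0∞)
    (u : ℝ → (Fin d → ℝ) → E) : ℝ≥0∞ :=
  LpBesovNorm T p α q u
    + ⨆ (τ : ℝ) (_ : τ ≠ 0),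
        timeLpOn (Set.Ioo (max 0 τ) (min T (T + τ))) p
            (fun t => besovNorm α q fun x => u (t - τ) x - u t x)
          / ENNReal.ofReal (|τ| ^ β)

/-- `u ∈ B^β_{p,∞}((0,T);B^α_{q,∞}(𝕋^d))`. -/
def MemBesovBesov (T β : ℝ) (p : ℝ≥0∞) (α : ℝ) (q : ℝ≥0∞)
    (u : ℝ → (Fin d → ℝ) → E) : Prop :=
  besovBesovNorm T β p α q u < ∞

/-- Classical partial derivative in time of a space-time function. -/
def pderivT (φ : ℝ → (Fin d → ℝ) → ℝ) (t : ℝ) (x : Fin d → ℝ) : ℝ :=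
  deriv (fun s => φ s x) t

/-- Classical partial derivative in the `i`-th space direction of a space-time function. -/
def pderivX (i : Fin d) (φ : ℝ → (Fin d → ℝ) → ℝ) (t : ℝ) (x : Fin d → ℝ) : ℝ :=
  fderiv ℝ (φ t) x (Pi.single i 1)

/-- Smooth test functions on `(0,T) × 𝕋^d`, compactly supported away from `t = 0` and
`t = T`, and periodic in space. -/
structure IsTestFunction (T : ℝ) (φ : ℝ → (Fin d → ℝ) → ℝ) : Prop where
  smooth : ContDiff ℝ (⊤ : ℕ∞) (Function.uncurry φ)
  periodic : ∀ t, SpacePeriodic (φ t)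
  supp : ∃ a b : ℝ, 0 < a ∧ b < T ∧ ∀ t x, t ∉ Set.Icc a b → φ t x = 0

/-- Smooth test functions on `[0,T) × 𝕋^d` (allowed to be nonzero at the initial time),
vanishing near `t = T`, and periodic in space. -/
structure IsTestFunctionIC (T : ℝ) (φ : ℝ → (Fin d → ℝ) → ℝ) : Prop where
  smooth : ContDiff ℝ (⊤ : ℕ∞) (Function.uncurry φ)
  periodic : ∀ t, SpacePeriodic (φ t)
  supp : ∃ b : ℝ, b < T ∧ ∀ t x, b ≤ t → φ t x = 0

/-- `g` is the weak time derivative of `f` on `(0,T) × 𝕋^d`. -/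
def HasWeakDerivT (T : ℝ) (f g : ℝ → (Fin d → ℝ) → ℝ) : Prop :=
  ∀ φ : ℝ → (Fin d → ℝ) → ℝ, IsTestFunction T φ →
    ∫ t in Set.Ioo 0 T, ∫ x in unitCube d, f t x * pderivT φ t x
      = - ∫ t in Set.Ioo 0 T, ∫ x in unitCube d, g t x * φ t x

/-- `g` is the weak `i`-th spatial derivative of `f` on `(0,T) × 𝕋^d`. -/
def HasWeakDerivX (T : ℝ) (i : Fin d) (f g : ℝ → (Fin d → ℝ) → ℝ) : Prop :=
  ∀ φ : ℝ → (Fin d → ℝ) → ℝ, IsTestFunction T φ →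
    ∫ t in Set.Ioo 0 T, ∫ x in unitCube d, f t x * pderivX i φ t x
      = - ∫ t in Set.Ioo 0 T, ∫ x in unitCube d, g t x * φ t x

/-- The weak time derivative of `f` belongs to `L^a(0,T;L^b(𝕋^d))`. -/
def DtInLpLq (T : ℝ) (a b : ℝ≥0∞) (f : ℝ → (Fin d → ℝ) → ℝ) : Prop :=
  ∃ g : ℝ → (Fin d → ℝ) → ℝ, HasWeakDerivT T f g ∧ MemLpLq T a b g

/-- The weak spatial gradient of `f` belongs to `L^a(0,T;L^b(𝕋^d))`. -/
def GradInLpLq (T : ℝ) (a b : ℝ≥0∞) (f : ℝ → (Fin d → ℝ) → ℝ) : Prop :=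
  ∃ G : ℝ → (Fin d → ℝ) → Fin d → ℝ,
    (∀ i, HasWeakDerivX T i f fun t x => G t x i) ∧ MemLpLq T a b G

/-- The constant `κ = (γ-1)²/(4γ)` in the pressure law `π(ρ) = κ ρ^γ`. -/
def kappa (γ : ℝ) : ℝ := (γ - 1) ^ 2 / (4 * γ)

/-- The total energy `E(t) = ∫_{𝕋^d} (½ ρ|v|² + κργ/(γ-1)) dx` at time `t`. -/
def energyAt (d : ℕ) (γ : ℝ) (ρ : ℝ → (Fin d → ℝ) → ℝ)
    (v : ℝ → (Fin d → ℝ) → Fin d → ℝ) (t : ℝ) : ℝ :=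
  ∫ x in unitCube d,
    ((1 / 2 : ℝ) * ρ t x * euNorm (v t x) ^ 2 + (kappa γ / (γ - 1)) * ρ t x ^ γ)

/-- The initial energy `E(0)`. -/
def energyInit (d : ℕ) (γ : ℝ) (ρ₀ : (Fin d → ℝ) → ℝ)
    (v₀ : (Fin d → ℝ) → Fin d → ℝ) : ℝ :=
  ∫ x in unitCube d,
    ((1 / 2 : ℝ) * ρ₀ x * euNorm (v₀ x) ^ 2 + (kappa γ / (γ - 1)) * ρ₀ x ^ γ)

/-- A weak solution of the isentropic compressible Euler equations
`∂ₜρ + div(ρv) = 0`, `∂ₜ(ρv) + div(ρv⊗v) + ∇(κρ^γ) = 0` on `(0,T) × 𝕋^d`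
with initial data `ρ(0) = ρ₀`, `(ρv)(0) = ρ₀v₀`:
both equations hold in the sense of distributions, `ρ^γ, ρ|v|² ∈ L^∞(0,T;L¹(𝕋^d))`,
`ρ` is a renormalized solution of the continuity equation, and the energy
inequality `E(t) ≤ E(0)` holds. -/
structure IsWeakSolution (d : ℕ) (T γ : ℝ) (ρ : ℝ → (Fin d → ℝ) → ℝ)
    (v : ℝ → (Fin d → ℝ) → Fin d → ℝ) (ρ₀ : (Fin d → ℝ) → ℝ)
    (v₀ : (Fin d → ℝ) → Fin d → ℝ) : Prop where
  rho_meas : Measurable (Function.uncurry ρ)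
  v_meas : Measurable (Function.uncurry v)
  rho_periodic : ∀ t, SpacePeriodic (ρ t)
  v_periodic : ∀ t, SpacePeriodic (v t)
  rho0_periodic : SpacePeriodic ρ₀
  v0_periodic : SpacePeriodic v₀
  rho_nonneg : ∀ t x, 0 ≤ ρ t x
  rho0_nonneg : ∀ x, 0 ≤ ρ₀ x
  v0_vacuum : ∀ x, ρ₀ x = 0 → v₀ x = 0
  pressure_int : MemLpLq T ∞ 1 fun t x => ρ t x ^ γ
  kinetic_int : MemLpLq T ∞ 1 fun t x => ρ t x * euNorm (v t x) ^ 2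
  mass : ∀ φ : ℝ → (Fin d → ℝ) → ℝ, IsTestFunctionIC T φ →
    (∫ t in Set.Ioo 0 T, ∫ x in unitCube d,
        (ρ t x * pderivT φ t x + ρ t x * (∑ i, v t x i * pderivX i φ t x)))
      + (∫ x in unitCube d, ρ₀ x * φ 0 x) = 0
  momentum : ∀ Φ : ℝ → (Fin d → ℝ) → Fin d → ℝ,
    (∀ j, IsTestFunctionIC T fun s y => Φ s y j) →
    (∫ t in Set.Ioo 0 T, ∫ x in unitCube d,
        ((∑ j, ρ t x * v t x j * pderivT (fun s y => Φ s y j) t x)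
          + (∑ i, ∑ j, ρ t x * v t x i * v t x j * pderivX i (fun s y => Φ s y j) t x)
          + kappa γ * ρ t x ^ γ * (∑ j, pderivX j (fun s y => Φ s y j) t x)))
      + (∫ x in unitCube d, (∑ j, ρ₀ x * v₀ x j * Φ 0 x j)) = 0
  renormalized : ∃ w : ℝ → (Fin d → ℝ) → ℝ,
    (∀ φ : ℝ → (Fin d → ℝ) → ℝ, IsTestFunction T φ →
      ∫ t in Set.Ioo 0 T, ∫ x in unitCube d, (∑ i, v t x i * pderivX i φ t x)
        = - ∫ t in Set.Ioo 0 T, ∫ x in unitCube d, w t x * φ t x) ∧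
    ∀ b : ℝ → ℝ, ContDiff ℝ 1 b → HasCompactSupport (deriv b) →
      ∀ φ : ℝ → (Fin d → ℝ) → ℝ, IsTestFunctionIC T φ →
        (∫ t in Set.Ioo 0 T, ∫ x in unitCube d,
            (b (ρ t x) * pderivT φ t x + b (ρ t x) * (∑ i, v t x i * pderivX i φ t x)
              - (deriv b (ρ t x) * ρ t x - b (ρ t x)) * w t x * φ t x))
          + (∫ x in unitCube d, b (ρ₀ x) * φ 0 x) = 0
  energy_ineq : ∀ᵐ t ∂(volume.restrict (Set.Ioo 0 T)),
    energyAt d γ ρ v t ≤ energyInit d γ ρ₀ v₀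

/-- The exponent `p/(p-3)`, read as `∞` when `p ≤ 3`. -/
def div3Exp (p : ℝ) : ℝ≥0∞ := if p ≤ 3 then ∞ else ENNReal.ofReal (p / (p - 3))

/-- The standard (non-normalized) spatial bump `e^{-1/(1-|x|²)}` for `|x| < 1`. -/
def bump (d : ℕ) (x : Fin d → ℝ) : ℝ :=
  if euNorm x < 1 then Real.exp (-(1 - euNorm x ^ 2)⁻¹) else 0

/-- The normalizing constant `C₀` with `∫ C₀ e^{-1/(1-|x|²)} dx = 1`. -/
def bumpConst (d : ℕ) : ℝ := (∫ x : Fin d → ℝ, bump d x)⁻¹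

/-- The rescaled standard spatial mollifier `η_ε(x) = ε^{-d} η(x/ε)`,
`η(x) = C₀ e^{-1/(1-|x|²)}`. -/
def sKer (d : ℕ) (ε : ℝ) (x : Fin d → ℝ) : ℝ :=
  (ε ^ d)⁻¹ * (bumpConst d * bump d (ε⁻¹ • x))

/-- Mollification in the space variable: `f^ε = f * η_ε`. -/
def sMollify {d : ℕ} {E : Type*} [NormedAddCommGroup E] [NormedSpace ℝ E]
    (ε : ℝ) (f : (Fin d → ℝ) → E) (x : Fin d → ℝ) : E :=
  ∫ y : Fin d → ℝ, sKer d ε (x - y) • f y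

/-- A space-time mollifying kernel: nonnegative, smooth, supported in the unit ball of
`ℝ^{1+d}`, with integral 1. -/
structure IsSTMollifier (d : ℕ) (η : ℝ → (Fin d → ℝ) → ℝ) : Prop where
  smooth : ContDiff ℝ (⊤ : ℕ∞) (Function.uncurry η)
  nonneg : ∀ t x, 0 ≤ η t x
  supp : ∀ t x, 1 ≤ t ^ 2 + euNorm x ^ 2 → η t x = 0
  integral_one : (∫ z : ℝ × (Fin d → ℝ), η z.1 z.2) = 1

/-- The rescaled space-time kernel `η_ε(t,x) = ε^{-(d+1)} η(t/ε, x/ε)`. -/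
def stKer (d : ℕ) (η : ℝ → (Fin d → ℝ) → ℝ) (ε : ℝ) (t : ℝ) (x : Fin d → ℝ) : ℝ :=
  (ε ^ (d + 1))⁻¹ * η (t / ε) (ε⁻¹ • x)

/-- Space-time mollification `f^ε(t,x) = ∫∫ η_ε(t-s, x-y) f(s,y) dy ds`. -/
def stMollify {d : ℕ} {E : Type*} [NormedAddCommGroup E] [NormedSpace ℝ E]
    (η : ℝ → (Fin d → ℝ) → ℝ) (ε : ℝ) (f : ℝ → (Fin d → ℝ) → E)
    (t : ℝ) (x : Fin d → ℝ) : E :=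
  ∫ z : ℝ × (Fin d → ℝ), stKer d η ε (t - z.1) (x - z.2) • f z.1 z.2


theorem aux_meas_eLpNorm {Z X : Type*} [MeasurableSpace Z] [MeasurableSpace X] (ν : Measure X)
    [SFinite ν] (p : ℝ≥0∞) {H : Z → X → ℝ≥0∞} (hH : Measurable (Function.uncurry H)) :
    Measurable fun z => eLpNorm (H z) p ν := by
  by_cases h0 : p = 0
  · simp [h0]
  by_cases ht : p = ∞
  · subst ht
    simp only [eLpNorm_exponent_top, eLpNormEssSup_eq_essSup_enorm, enorm_eq_self]
    refine measurable_of_Iic fun c => ?_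
    have : (fun z => essSup (H z) ν) ⁻¹' Set.Iic c = {z | ν {x | c < H z x} = 0} := by
      ext z
      simp only [Set.mem_preimage, Set.mem_Iic, Set.mem_ofPred_eq]
      constructor
      · intro h
        have : ∀ᵐ x ∂ν, H z x ≤ c := by
          filter_upwards [ENNReal.ae_le_essSup (H z)] with x hx using hx.trans h
        rw [ae_iff] at this
        simpa using this
      · intro h
        refine essSup_le_of_ae_le _ ?_
        change ∀ᵐ x ∂ν, H z x ≤ c
        rw [ae_iff]
        simpa using h
    rw [this]
    have hs : MeasurableSet {w : Z × X | c < H w.1 w.2} := measurableSet_lt measurable_const hH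
    exact measurable_measure_prodMk_left hs (measurableSet_singleton 0)
  · simp only [eLpNorm_eq_lintegral_rpow_enorm_toReal h0 ht, enorm_eq_self]
    exact (Measurable.lintegral_prod_right' (f := fun w : Z × X => H w.1 w.2 ^ p.toReal)
      (hH.pow_const _)).pow_const _

theorem aux_minkowski_real {Z X : Type*} [MeasurableSpace Z] [MeasurableSpace X] (μ : Measure Z)
    (ν : Measure X) [SFinite μ] [IsFiniteMeasure ν] {q : ℝ} (hq : 1 < q) {H : Z → X → ℝ≥0∞}
    (hH : Measurable (Function.uncurry H)) :
    (∫⁻ x, (∫⁻ z, H z x ∂μ) ^ q ∂ν) ^ (1 / q) ≤ ∫⁻ z, (∫⁻ x, H z x ^ q ∂ν) ^ (1 / q) ∂μ := by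
  set M := ∫⁻ z, (∫⁻ x, H z x ^ q ∂ν) ^ (1 / q) ∂μ with hM
  set Φ : X → ℝ≥0∞ := fun x => ∫⁻ z, H z x ∂μ with hΦ
  have hq0 : 0 < q := by linarith
  have mH : Measurable fun w : X × Z => H w.2 w.1 := hH.comp measurable_swap
  have mΦ : Measurable Φ := Measurable.lintegral_prod_right' (f := fun w : X × Z => H w.2 w.1) mH
  have hconj : q.HolderConjugate (q / (q - 1)) := Real.HolderConjugate.conjExponent hq
  have key : ∀ n : ℕ, ∫⁻ x, (min (Φ x) n) ^ q ∂ν ≤ M ^ q := by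
    intro n
    set I := ∫⁻ x, (min (Φ x) n) ^ q ∂ν with hI
    have mn : Measurable fun x => min (Φ x) (n : ℝ≥0∞) := mΦ.min measurable_const
    have hItop : I ≠ ∞ := by
      refine ne_of_lt ?_
      calc I ≤ ∫⁻ x, (n : ℝ≥0∞) ^ q ∂ν :=
            lintegral_mono fun x => ENNReal.rpow_le_rpow (min_le_right _ _) hq0.le
        _ < ∞ := by
            rw [lintegral_const]
            exact ENNReal.mul_lt_top (ENNReal.rpow_lt_top_of_nonneg hq0.le (by simp))
              (measure_lt_top _ _)
    by_cases hI0 : I = 0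
    · rw [hI0]; exact zero_le
    have h1 : I ≤ M * I ^ (1 / (q / (q - 1))) := by
      calc I ≤ ∫⁻ x, Φ x * (min (Φ x) n) ^ (q - 1) ∂ν := by
            refine lintegral_mono fun x => ?_
            have hnt : min (Φ x) (n : ℝ≥0∞) ≠ ∞ := ne_top_of_le_ne_top (by simp) (min_le_right _ _)
            calc (min (Φ x) (n : ℝ≥0∞)) ^ q = (min (Φ x) (n : ℝ≥0∞)) ^ (1 + (q - 1)) := by ring_nf
              _ = (min (Φ x) (n : ℝ≥0∞)) * (min (Φ x) (n : ℝ≥0∞)) ^ (q - 1) := by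
                rw [ENNReal.rpow_add_of_nonneg _ _ zero_le_one (by linarith), ENNReal.rpow_one]
              _ ≤ _ := by gcongr; exact min_le_left _ _
        _ = ∫⁻ x, ∫⁻ z, H z x * (min (Φ x) n) ^ (q - 1) ∂μ ∂ν := by
            refine lintegral_congr fun x => ?_
            rw [lintegral_mul_const]
            exact mH.comp measurable_prodMk_left
        _ = ∫⁻ z, ∫⁻ x, H z x * (min (Φ x) n) ^ (q - 1) ∂ν ∂μ := by
            refine lintegral_lintegral_swap ?_
            exact (mH.mul ((mn.pow_const _).comp measurable_fst)).aemeasurable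
        _ ≤ ∫⁻ z, (∫⁻ x, H z x ^ q ∂ν) ^ (1 / q) * I ^ (1 / (q / (q - 1))) ∂μ := by
            refine lintegral_mono fun z => ?_
            have := ENNReal.lintegral_mul_le_Lp_mul_Lq ν hconj (f := H z)
              (g := fun x => (min (Φ x) n) ^ (q - 1))
              (hH.comp measurable_prodMk_left).aemeasurable (mn.pow_const _).aemeasurable
            refine this.trans_eq ?_
            congr 2
            refine lintegral_congr fun x => ?_
            rw [← ENNReal.rpow_mul]
            congr 1
            field_simp [show q - 1 ≠ 0 by linarith]
        _ = M * I ^ (1 / (q / (q - 1))) := by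
            rw [lintegral_mul_const]
            refine Measurable.pow_const ?_ _
            exact Measurable.lintegral_prod_right' (f := fun w : Z × X => H w.1 w.2 ^ q)
              (hH.pow_const _)
    have hb : 1 / q + 1 / (q / (q - 1)) = 1 := by
      field_simp [show q - 1 ≠ 0 by linarith]; ring
    have hbt : I ^ (1 / (q / (q - 1))) ≠ ∞ :=
      ENNReal.rpow_ne_top_of_nonneg (by have : 0 < q - 1 := by linarith
                                        positivity) hItop
    have hb0 : I ^ (1 / (q / (q - 1))) ≠ 0 := by
      simp [ENNReal.rpow_eq_zero_iff, hI0, hItop]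
    have h2 : I ^ (1 / q) ≤ M := by
      have h3 : I ^ (1 / q) * I ^ (1 / (q / (q - 1))) ≤ M * I ^ (1 / (q / (q - 1))) := by
        rw [← ENNReal.rpow_add _ _ hI0 hItop, hb, ENNReal.rpow_one]; exact h1
      exact (ENNReal.mul_le_mul_iff_left hb0 hbt).1 h3
    calc I = (I ^ (1 / q)) ^ q := by
          rw [← ENNReal.rpow_mul, one_div_mul_cancel hq0.ne', ENNReal.rpow_one]
      _ ≤ M ^ q := ENNReal.rpow_le_rpow h2 hq0.le
  have hsup : ∫⁻ x, Φ x ^ q ∂ν = ⨆ n : ℕ, ∫⁻ x, (min (Φ x) n) ^ q ∂ν := by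
    rw [← lintegral_iSup (fun n => (mΦ.min measurable_const).pow_const _)]
    · refine lintegral_congr fun x => ?_
      have : Φ x = ⨆ n : ℕ, min (Φ x) n := by
        rw [← inf_iSup_eq, ENNReal.iSup_natCast, inf_top_eq]
      conv_lhs => rw [this]
      exact (ENNReal.orderIsoRpow q hq0).map_iSup _
    · intro a b hab x
      exact ENNReal.rpow_le_rpow (min_le_min le_rfl (by exact_mod_cast hab)) hq0.le
  change (∫⁻ x, Φ x ^ q ∂ν) ^ (1 / q) ≤ M
  rw [one_div, ENNReal.rpow_inv_le_iff hq0, hsup]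
  exact iSup_le key

theorem aux_minkowski {Z X : Type*} [MeasurableSpace Z] [MeasurableSpace X] (μ : Measure Z)
    (ν : Measure X) [SFinite μ] [IsFiniteMeasure ν] {q : ℝ≥0∞} (hq : 1 ≤ q) {H : Z → X → ℝ≥0∞}
    (hH : Measurable (Function.uncurry H)) :
    eLpNorm (fun x => ∫⁻ z, H z x ∂μ) q ν ≤ ∫⁻ z, eLpNorm (H z) q ν ∂μ := by
  have h0 : q ≠ 0 := (zero_lt_one.trans_le hq).ne'
  by_cases ht : q = ∞
  · subst ht
    have mD := aux_meas_eLpNorm ν ∞ hH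
    simp only [eLpNorm_exponent_top, eLpNormEssSup_eq_essSup_enorm, enorm_eq_self] at mD ⊢
    refine essSup_le_of_ae_le _ ?_
    have h1 : ∀ᵐ w ∂(μ.prod ν), H w.1 w.2 ≤ essSup (H w.1) ν := by
      refine Measure.ae_prod_iff_ae_ae ?_ |>.2 ?_
      · exact measurableSet_le hH (mD.comp measurable_fst)
      · exact Filter.Eventually.of_forall fun z => ENNReal.ae_le_essSup (H z)
    have h2 : ∀ᵐ w ∂(ν.prod μ), H w.2 w.1 ≤ essSup (H w.2) ν := by
      have := (Measure.measurePreserving_swap (μ := ν) (ν := μ)).quasiMeasurePreserving.ae h1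
      simpa using this
    filter_upwards [Measure.ae_ae_of_ae_prod h2] with x hx
    exact lintegral_mono_ae hx
  rcases hq.eq_or_lt with h1 | h1
  · subst h1
    simp only [eLpNorm_one_eq_lintegral_enorm, enorm_eq_self]
    rw [lintegral_lintegral_swap]
    exact (hH.comp measurable_swap).aemeasurable
  · simp only [eLpNorm_eq_lintegral_rpow_enorm_toReal h0 ht, enorm_eq_self]
    refine aux_minkowski_real μ ν ?_ hH
    rw [← ENNReal.toReal_one]
    exact (ENNReal.toReal_lt_toReal (by simp) ht).2 h1

theorem aux_holder_top {X : Type*} [MeasurableSpace X] (ν : Measure X) {p : ℝ≥0∞} (hp : 1 ≤ p)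
    {f g : X → ℝ≥0∞} (hg : Measurable g) :
    eLpNorm (fun x => f x * g x) p ν ≤ eLpNorm f ∞ ν * eLpNorm g p ν := by
  have h0 : p ≠ 0 := (zero_lt_one.trans_le hp).ne'
  simp only [eLpNorm_exponent_top, eLpNormEssSup_eq_essSup_enorm, enorm_eq_self]
  by_cases ht : p = ∞
  · subst ht
    simp only [eLpNorm_exponent_top, eLpNormEssSup_eq_essSup_enorm, enorm_eq_self]
    exact ENNReal.essSup_mul_le f g
  have hpos : 0 < p.toReal := ENNReal.toReal_pos h0 ht
  simp only [eLpNorm_eq_lintegral_rpow_enorm_toReal h0 ht, enorm_eq_self]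
  rw [one_div, ENNReal.rpow_inv_le_iff hpos, ENNReal.mul_rpow_of_nonneg _ _ hpos.le,
    ENNReal.rpow_inv_rpow hpos.ne', ← lintegral_const_mul _ (hg.pow_const _)]
  refine lintegral_mono_ae ?_
  filter_upwards [ENNReal.ae_le_essSup f] with x hx
  rw [ENNReal.mul_rpow_of_nonneg _ _ hpos.le]
  gcongr

theorem aux_holder {X : Type*} [MeasurableSpace X] (ν : Measure X) {p p₁ p₂ : ℝ≥0∞} (hp : 1 ≤ p)
    (hp₁ : 1 ≤ p₁) (hp₂ : 1 ≤ p₂)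
    (hpp : 1 / p = 1 / p₁ + 1 / p₂) {f g : X → ℝ≥0∞} (hf : Measurable f) (hg : Measurable g) :
    eLpNorm (fun x => f x * g x) p ν ≤ eLpNorm f p₁ ν * eLpNorm g p₂ ν := by
  by_cases ht₁ : p₁ = ∞
  · subst ht₁
    have : p = p₂ := by simpa using hpp
    subst this
    exact aux_holder_top ν hp hg
  by_cases ht₂ : p₂ = ∞
  · subst ht₂
    have : p = p₁ := by simpa using hpp
    subst this
    simp only [mul_comm (f _)]
    rw [mul_comm]
    exact aux_holder_top ν hp hf
  have h01 : p₁ ≠ 0 := (zero_lt_one.trans_le hp₁).ne'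
  have h02 : p₂ ≠ 0 := (zero_lt_one.trans_le hp₂).ne'
  have h0 : p ≠ 0 := (zero_lt_one.trans_le hp).ne'
  have ht : p ≠ ∞ := by
    rintro rfl
    have h := hpp.symm
    simp [ht₁] at h
  have r1 : 0 < p₁.toReal := ENNReal.toReal_pos h01 ht₁
  have r2 : 0 < p₂.toReal := ENNReal.toReal_pos h02 ht₂
  have r0 : 0 < p.toReal := ENNReal.toReal_pos h0 ht
  have hpp' : 1 / p.toReal = 1 / p₁.toReal + 1 / p₂.toReal := by
    have := congrArg ENNReal.toReal hpp
    rw [ENNReal.toReal_add (by simpa using h01) (by simpa using h02)] at this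
    simpa using this
  simp only [eLpNorm_eq_lintegral_rpow_enorm_toReal h0 ht, eLpNorm_eq_lintegral_rpow_enorm_toReal h01 ht₁,
    eLpNorm_eq_lintegral_rpow_enorm_toReal h02 ht₂, enorm_eq_self]
  refine ENNReal.lintegral_Lp_mul_le_Lq_mul_Lr r0 ?_ hpp' ν hf.aemeasurable hg.aemeasurable
  refine lt_of_one_div_lt_one_div r1 ?_
  rw [hpp']
  have : 0 < 1 / p₂.toReal := by positivity
  linarith

theorem aux_commutator {Z : Type*} [MeasurableSpace Z] (μ : Measure Z) [IsProbabilityMeasure μ]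
    {F G : Z → ℝ} (hF : Measurable F) (hG : Measurable G) (a b : ℝ) :
    ‖(∫ z, F z * G z ∂μ) - (∫ z, F z ∂μ) * ∫ z, G z ∂μ‖ₑ ≤
      (∫⁻ z, ‖F z - a‖ₑ * ‖G z - b‖ₑ ∂μ) + (∫⁻ z, ‖F z - a‖ₑ ∂μ) * ∫⁻ z, ‖G z - b‖ₑ ∂μ := by
  by_cases hB0 : ∫⁻ z, ‖G z - b‖ₑ ∂μ = 0
  · rw [lintegral_eq_zero_iff (by fun_prop)] at hB0
    have hGb : G =ᵐ[μ] fun _ => b := by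
      filter_upwards [hB0] with z hz
      simpa [sub_eq_zero] using hz
    have h1 : ∫ z, F z * G z ∂μ = (∫ z, F z ∂μ) * b := by
      rw [← integral_mul_const]
      refine integral_congr_ae ?_
      filter_upwards [hGb] with z hz
      rw [hz]
    have h2 : ∫ z, G z ∂μ = b := by
      rw [integral_congr_ae hGb]; simp
    simp [h1, h2]
  by_cases hA0 : ∫⁻ z, ‖F z - a‖ₑ ∂μ = 0
  · rw [lintegral_eq_zero_iff (by fun_prop)] at hA0
    have hGb : F =ᵐ[μ] fun _ => a := by
      filter_upwards [hA0] with z hz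
      simpa [sub_eq_zero] using hz
    have h1 : ∫ z, F z * G z ∂μ = a * (∫ z, G z ∂μ) := by
      rw [← integral_const_mul]
      refine integral_congr_ae ?_
      filter_upwards [hGb] with z hz
      rw [hz]
    have h2 : ∫ z, F z ∂μ = a := by
      rw [integral_congr_ae hGb]; simp
    simp [h1, h2]
  by_cases hAt : ∫⁻ z, ‖F z - a‖ₑ ∂μ = ∞
  · simp [hAt, hB0]
  by_cases hBt : ∫⁻ z, ‖G z - b‖ₑ ∂μ = ∞
  · simp [hBt, hA0]
  by_cases hCt : ∫⁻ z, ‖F z - a‖ₑ * ‖G z - b‖ₑ ∂μ = ∞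
  · simp [hCt]
  have iF : Integrable (fun z => F z - a) μ := ⟨by fun_prop, lt_top_iff_ne_top.2 hAt⟩
  have iG : Integrable (fun z => G z - b) μ := ⟨by fun_prop, lt_top_iff_ne_top.2 hBt⟩
  have iFG : Integrable (fun z => (F z - a) * (G z - b)) μ := by
    refine ⟨by fun_prop, lt_top_iff_ne_top.2 ?_⟩
    simpa only [enorm_mul] using hCt
  have e1 : ∫ z, F z ∂μ = (∫ z, (F z - a) ∂μ) + a := by
    have := integral_add iF (integrable_const a)
    simpa using this
  have e2 : ∫ z, G z ∂μ = (∫ z, (G z - b) ∂μ) + b := by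
    have := integral_add iG (integrable_const b)
    simpa using this
  have e3 : ∫ z, F z * G z ∂μ = (∫ z, (F z - a) * (G z - b) ∂μ) + b * (∫ z, (F z - a) ∂μ)
      + a * (∫ z, (G z - b) ∂μ) + a * b := by
    have : ∀ z, F z * G z = (F z - a) * (G z - b) + b * (F z - a) + a * (G z - b) + a * b := by
      intro z; ring
    simp_rw [this]
    rw [integral_add, integral_add, integral_add, integral_const_mul, integral_const_mul]
    · simp
    all_goals fun_prop
  have e : (∫ z, F z * G z ∂μ) - (∫ z, F z ∂μ) * ∫ z, G z ∂μ
      = (∫ z, (F z - a) * (G z - b) ∂μ) - (∫ z, (F z - a) ∂μ) * ∫ z, (G z - b) ∂μ := by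
    rw [e1, e2, e3]; ring
  rw [e]
  refine (enorm_sub_le).trans (add_le_add ?_ ?_)
  · simpa only [enorm_mul] using enorm_integral_le_lintegral_enorm (μ := μ) fun z => (F z - a) * (G z - b)
  · rw [enorm_mul]
    gcongr <;> exact enorm_integral_le_lintegral_enorm _

theorem aux_timeLpOn (s : Set ℝ) {p : ℝ≥0∞} (hp : 1 ≤ p) (F : ℝ → ℝ≥0∞) :
    timeLpOn s p F = eLpNorm F p (volume.restrict s) := by
  have h0 : p ≠ 0 := (zero_lt_one.trans_le hp).ne'
  unfold timeLpOn
  split_ifs with h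
  · subst h
    simp [eLpNorm_exponent_top, eLpNormEssSup_eq_essSup_enorm]
  · simp [eLpNorm_eq_lintegral_rpow_enorm_toReal h0 h]

instance aux_finite_cube (d : ℕ) : IsFiniteMeasure (cubeVol d) := by
  unfold cubeVol unitCube
  refine ⟨?_⟩
  rw [Measure.restrict_apply_univ, Real.volume_pi_Ico]
  simp

theorem aux_euNorm_pos {d : ℕ} {y : Fin d → ℝ} (hy : y ≠ 0) : 0 < euNorm y := by
  refine Real.sqrt_pos.2 ?_
  obtain ⟨i, hi⟩ := Function.ne_iff.1 hy
  refine Finset.sum_pos' (fun i _ => sq_nonneg _) ⟨i, Finset.mem_univ _, ?_⟩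
  have : y i ≠ 0 := hi
  positivity

theorem aux_euNorm_nonneg {d : ℕ} (y : Fin d → ℝ) : 0 ≤ euNorm y := Real.sqrt_nonneg _

theorem aux_euNorm_smul {d : ℕ} (c : ℝ) (y : Fin d → ℝ) :
    euNorm (c • y) ^ 2 = c ^ 2 * euNorm y ^ 2 := by
  unfold euNorm
  rw [Real.sq_sqrt (Finset.sum_nonneg fun i _ => sq_nonneg _),
    Real.sq_sqrt (Finset.sum_nonneg fun i _ => sq_nonneg _), Finset.mul_sum]
  simp [mul_pow]

theorem aux_space_shift {d : ℕ} (α : ℝ) (q : ℝ≥0∞) (f : (Fin d → ℝ) → ℝ) (y : Fin d → ℝ) :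
    eLpNorm (fun x => f (x - y) - f x) q (cubeVol d)
      ≤ ENNReal.ofReal (euNorm y ^ α) * besovNorm α q f := by
  by_cases hy : y = 0
  · subst hy; simp
  have h : eLpNorm (fun x => f (x - y) - f x) q (cubeVol d) / ENNReal.ofReal (euNorm y ^ α)
      ≤ besovNorm α q f := by
    refine le_trans ?_ (le_add_left (le_refl (besovSeminorm α q f)))
    exact le_iSup₂ (f := fun (y : Fin d → ℝ) (_ : y ≠ 0) =>
      eLpNorm (fun x => f (x - y) - f x) q (cubeVol d) / ENNReal.ofReal (euNorm y ^ α)) y hy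
  have hpos : 0 < euNorm y ^ α := Real.rpow_pos_of_pos (aux_euNorm_pos hy) _
  rw [ENNReal.div_le_iff (by simpa using hpos) (by simp)] at h
  rwa [mul_comm]

theorem aux_time_shift {d : ℕ} (T β : ℝ) {p : ℝ≥0∞} (hp : 1 ≤ p) (α : ℝ) (q : ℝ≥0∞)
    (f : ℝ → (Fin d → ℝ) → ℝ) (τ : ℝ) :
    eLpNorm (fun t => eLpNorm (fun x => f (t - τ) x - f t x) q (cubeVol d)) p
      (volume.restrict (Set.Ioo (max 0 τ) (min T (T + τ))))
      ≤ ENNReal.ofReal (|τ| ^ β) * besovBesovNorm T β p α q f := by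
  by_cases hy : τ = 0
  · subst hy; simp
  have h : timeLpOn (Set.Ioo (max 0 τ) (min T (T + τ))) p
            (fun t => besovNorm α q fun x => f (t - τ) x - f t x)
          / ENNReal.ofReal (|τ| ^ β) ≤ besovBesovNorm T β p α q f := by
    unfold besovBesovNorm
    refine le_trans ?_ (le_add_left le_rfl)
    exact le_iSup₂ (f := fun (τ : ℝ) (_ : τ ≠ 0) =>
      timeLpOn (Set.Ioo (max 0 τ) (min T (T + τ))) p
            (fun t => besovNorm α q fun x => f (t - τ) x - f t x)
          / ENNReal.ofReal (|τ| ^ β)) τ hy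
  have hpos : 0 < |τ| ^ β := Real.rpow_pos_of_pos (abs_pos.2 hy) _
  rw [ENNReal.div_le_iff (by simpa using hpos) (by simp), aux_timeLpOn _ hp] at h
  rw [mul_comm]
  refine le_trans (eLpNorm_mono_enorm fun t => ?_) h
  simp only [enorm_eq_self]
  exact le_self_add

theorem aux_eLpNorm_const_mul {X : Type*} [MeasurableSpace X] (ν : Measure X) {p : ℝ≥0∞}
    (hp : 1 ≤ p) {c : ℝ≥0∞} (hc : c ≠ ∞) (F : X → ℝ≥0∞) :
    eLpNorm (fun x => c * F x) p ν ≤ c * eLpNorm F p ν := by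
  have h0 : p ≠ 0 := (zero_lt_one.trans_le hp).ne'
  by_cases ht : p = ∞
  · subst ht
    simp only [eLpNorm_exponent_top, eLpNormEssSup_eq_essSup_enorm, enorm_eq_self]
    exact (ENNReal.essSup_const_mul).le
  have hpos : 0 < p.toReal := ENNReal.toReal_pos h0 ht
  simp only [eLpNorm_eq_lintegral_rpow_enorm_toReal h0 ht, enorm_eq_self]
  rw [one_div, ENNReal.rpow_inv_le_iff hpos, ENNReal.mul_rpow_of_nonneg _ _ hpos.le,
    ENNReal.rpow_inv_rpow hpos.ne',
    ← lintegral_const_mul' _ _ (ENNReal.rpow_ne_top_of_nonneg hpos.le hc)]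
  simp only [ENNReal.mul_rpow_of_nonneg _ _ hpos.le]
  exact le_rfl

/-- The spatial norm of a space-time increment. -/
def auxD {d : ℕ} (q : ℝ≥0∞) (f : ℝ → (Fin d → ℝ) → ℝ) (w : ℝ × (Fin d → ℝ)) (t : ℝ) : ℝ≥0∞ :=
  eLpNorm (fun x => ‖f (t - w.1) (x - w.2) - f t x‖ₑ) q (cubeVol d)

theorem auxD_meas {d : ℕ} (q : ℝ≥0∞) {f : ℝ → (Fin d → ℝ) → ℝ}
    (hf : Measurable (Function.uncurry f)) : Measurable (Function.uncurry (auxD q f)) := by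
  refine aux_meas_eLpNorm (Z := (ℝ × (Fin d → ℝ)) × ℝ) (cubeVol d) q
    (H := fun v x => ‖f (v.2 - v.1.1) (x - v.1.2) - f v.2 x‖ₑ) ?_
  refine Measurable.enorm (Measurable.sub ?_ ?_)
  · exact hf.comp (g := Function.uncurry f) (f := fun u : ((ℝ × (Fin d → ℝ)) × ℝ) × (Fin d → ℝ) =>
      (u.1.2 - u.1.1.1, u.2 - u.1.1.2)) (by fun_prop)
  · exact hf.comp (g := Function.uncurry f) (f := fun u : ((ℝ × (Fin d → ℝ)) × ℝ) × (Fin d → ℝ) =>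
      (u.1.2, u.2)) (by fun_prop)

theorem aux_shift {d : ℕ} (T : ℝ) {α β : ℝ} (hα : 0 < α) (hβ : α ≤ β) {p q : ℝ≥0∞} (hp : 1 ≤ p)
    (hq : 1 ≤ q) {f : ℝ → (Fin d → ℝ) → ℝ} (hf : Measurable (Function.uncurry f)) {ε : ℝ}
    (hε : 0 < ε) {w : ℝ × (Fin d → ℝ)} (hw1 : |w.1| < ε) (hw2 : euNorm w.2 < ε) :
    eLpNorm (auxD q f w) p (volume.restrict (Set.Ioo ε (T - ε)))
      ≤ ENNReal.ofReal (1 + T ^ (β - α)) * ENNReal.ofReal (ε ^ α) * besovBesovNorm T β p α q f := by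
  by_cases hT : T - ε ≤ ε
  · simp [Set.Ioo_eq_empty_of_le hT]
  have hεT : ε < T := by linarith
  have hT0 : 0 < T := by linarith
  obtain ⟨τ, y⟩ := w
  simp only at hw1 hw2
  have hτ := abs_lt.1 hw1
  set A : ℝ → ℝ≥0∞ := fun t => eLpNorm (fun x => ‖f t (x - y) - f t x‖ₑ) q (cubeVol d) with hA
  set B : ℝ → ℝ≥0∞ := fun t => eLpNorm (fun x => ‖f (t - τ) x - f t x‖ₑ) q (cubeVol d) with hB
  have mf : ∀ {u : ℝ × (Fin d → ℝ) → ℝ} {v : ℝ × (Fin d → ℝ) → (Fin d → ℝ)}, Measurable u →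
      Measurable v → Measurable fun z => f (u z) (v z) := fun hu hv => hf.comp (hu.prodMk hv)
  have mA : Measurable A := by
    refine aux_meas_eLpNorm (cubeVol d) q (H := fun t x => ‖f t (x - y) - f t x‖ₑ) ?_
    exact ((mf (by fun_prop) (by fun_prop)).sub (mf (by fun_prop) (by fun_prop))).enorm
  have mB : Measurable B := by
    refine aux_meas_eLpNorm (cubeVol d) q (H := fun t x => ‖f (t - τ) x - f t x‖ₑ) ?_
    exact ((mf (by fun_prop) (by fun_prop)).sub (mf (by fun_prop) (by fun_prop))).enorm
  have mx : ∀ {v : (Fin d → ℝ) → (Fin d → ℝ)} (t : ℝ), Measurable v →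
      Measurable fun x => f t (v x) := fun t hv => hf.comp (measurable_const.prodMk hv)
  have h1 : ∀ t, auxD q f (τ, y) t ≤ A (t - τ) + B t := by
    intro t
    simp only [auxD, hA, hB]
    refine le_trans (eLpNorm_mono_enorm (g := (fun x => ‖f (t - τ) (x - y) - f (t - τ) x‖ₑ)
      + fun x => ‖f (t - τ) x - f t x‖ₑ) fun x => ?_) (eLpNorm_add_le ?_ ?_ hq)
    · simp only [enorm_eq_self, Pi.add_apply]
      calc ‖f (t - τ) (x - y) - f t x‖ₑ
          = ‖(f (t - τ) (x - y) - f (t - τ) x) + (f (t - τ) x - f t x)‖ₑ := by congr 1; ring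
        _ ≤ _ := enorm_add_le _ _
    · exact ((mx _ (by fun_prop)).sub (mx _ (by fun_prop))).enorm.aestronglyMeasurable
    · exact ((mx _ (by fun_prop)).sub (mx _ (by fun_prop))).enorm.aestronglyMeasurable
  have h2 : eLpNorm (fun t => A (t - τ)) p (volume.restrict (Set.Ioo ε (T - ε)))
      ≤ ENNReal.ofReal (ε ^ α) * besovBesovNorm T β p α q f := by
    have hmp : MeasurePreserving (fun t : ℝ => t - τ)
        (volume.restrict ((fun t : ℝ => t - τ) ⁻¹' Set.Ioo 0 T)) (volume.restrict (Set.Ioo 0 T)) :=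
      (measurePreserving_sub_right volume τ).restrict_preimage measurableSet_Ioo
    calc eLpNorm (fun t => A (t - τ)) p (volume.restrict (Set.Ioo ε (T - ε)))
        ≤ eLpNorm (fun t => A (t - τ)) p
            (volume.restrict ((fun t : ℝ => t - τ) ⁻¹' Set.Ioo 0 T)) := by
          refine eLpNorm_mono_measure _ (Measure.restrict_mono ?_ le_rfl)
          intro t ht
          simp only [Set.mem_preimage, Set.mem_Ioo] at ht ⊢
          constructor <;> linarith
      _ = eLpNorm A p (volume.restrict (Set.Ioo 0 T)) :=
          eLpNorm_comp_measurePreserving mA.aestronglyMeasurable hmp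
      _ ≤ eLpNorm (fun t => ENNReal.ofReal (ε ^ α) * besovNorm α q (f t)) p
            (volume.restrict (Set.Ioo 0 T)) := by
          refine eLpNorm_mono_enorm fun t => ?_
          simp only [enorm_eq_self, hA, eLpNorm_enorm]
          refine (aux_space_shift α q (f t) y).trans ?_
          gcongr
          exact aux_euNorm_nonneg y
      _ ≤ ENNReal.ofReal (ε ^ α) * eLpNorm (fun t => besovNorm α q (f t)) p
            (volume.restrict (Set.Ioo 0 T)) := aux_eLpNorm_const_mul _ hp (by simp) _
      _ ≤ _ := by
          gcongr
          unfold besovBesovNorm LpBesovNorm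
          rw [aux_timeLpOn _ hp]
          exact le_self_add
  have h3 : eLpNorm B p (volume.restrict (Set.Ioo ε (T - ε)))
      ≤ ENNReal.ofReal (T ^ (β - α)) * ENNReal.ofReal (ε ^ α) * besovBesovNorm T β p α q f := by
    calc eLpNorm B p (volume.restrict (Set.Ioo ε (T - ε)))
        ≤ eLpNorm B p (volume.restrict (Set.Ioo (max 0 τ) (min T (T + τ)))) := by
          refine eLpNorm_mono_measure _ (Measure.restrict_mono ?_ le_rfl)
          refine Set.Ioo_subset_Ioo (max_le hε.le hτ.2.le) (le_min ?_ ?_) <;> linarith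
      _ ≤ ENNReal.ofReal (|τ| ^ β) * besovBesovNorm T β p α q f := by
          simp only [hB, eLpNorm_enorm]
          exact aux_time_shift T β hp α q f τ
      _ ≤ _ := by
          rw [← ENNReal.ofReal_mul (by positivity)]
          gcongr
          calc |τ| ^ β ≤ ε ^ β := Real.rpow_le_rpow (abs_nonneg _) hw1.le (by linarith)
            _ = ε ^ (β - α) * ε ^ α := by rw [← Real.rpow_add hε]; ring_nf
            _ ≤ T ^ (β - α) * ε ^ α := by
                gcongr
  calc eLpNorm (auxD q f (τ, y)) p (volume.restrict (Set.Ioo ε (T - ε)))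
      ≤ eLpNorm ((fun t => A (t - τ)) + B) p (volume.restrict (Set.Ioo ε (T - ε))) :=
        eLpNorm_mono_enorm fun t => by simpa using h1 t
    _ ≤ _ := eLpNorm_add_le (mA.comp (measurable_id.sub_const τ)).aestronglyMeasurable
          mB.aestronglyMeasurable hp
    _ ≤ _ := add_le_add h2 h3
    _ = _ := by
        rw [ENNReal.ofReal_add zero_le_one (by positivity), ENNReal.ofReal_one]
        ring

/-- The mollifying probability measure. -/
def auxMu {d : ℕ} (η : ℝ → (Fin d → ℝ) → ℝ) (ε : ℝ) : Measure (ℝ × (Fin d → ℝ)) :=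
  volume.withDensity fun w => ENNReal.ofReal (stKer d η ε w.1 w.2)

theorem auxKer_meas {d : ℕ} {η : ℝ → (Fin d → ℝ) → ℝ} (hη : IsSTMollifier d η) (ε : ℝ) :
    Continuous fun w : ℝ × (Fin d → ℝ) => stKer d η ε w.1 w.2 := by
  unfold stKer
  refine continuous_const.mul ?_
  exact hη.smooth.continuous.comp (g := Function.uncurry η)
    (f := fun w : ℝ × (Fin d → ℝ) => (w.1 / ε, ε⁻¹ • w.2)) (by fun_prop)

theorem auxKer_nonneg {d : ℕ} {η : ℝ → (Fin d → ℝ) → ℝ} (hη : IsSTMollifier d η) {ε : ℝ}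
    (hε : 0 < ε) (t : ℝ) (x : Fin d → ℝ) : 0 ≤ stKer d η ε t x :=
  mul_nonneg (by positivity) (hη.nonneg _ _)

theorem auxMu_integral {d : ℕ} {η : ℝ → (Fin d → ℝ) → ℝ} (hη : IsSTMollifier d η) {ε : ℝ}
    (hε : 0 < ε) (F : ℝ × (Fin d → ℝ) → ℝ) :
    ∫ w, F w ∂(auxMu η ε) = ∫ w, stKer d η ε w.1 w.2 • F w := by
  unfold auxMu
  rw [integral_withDensity_eq_integral_toReal_smul
    (auxKer_meas hη ε).measurable.ennreal_ofReal (by simp)]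
  simp only [ENNReal.toReal_ofReal (auxKer_nonneg hη hε _ _)]

theorem auxMu_prob {d : ℕ} {η : ℝ → (Fin d → ℝ) → ℝ} (hη : IsSTMollifier d η) {ε : ℝ}
    (hε : 0 < ε) : IsProbabilityMeasure (auxMu η ε) := by
  have h1 : ∫ w : ℝ × (Fin d → ℝ), stKer d η ε w.1 w.2 = 1 := by
    unfold stKer
    rw [integral_const_mul]
    have hH : (volume : Measure (ℝ × (Fin d → ℝ))).IsAddHaarMeasure :=
      inferInstanceAs ((volume : Measure ℝ).prod (volume : Measure (Fin d → ℝ))).IsAddHaarMeasure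
    have := Measure.integral_comp_smul (volume : Measure (ℝ × (Fin d → ℝ)))
      (fun z => η z.1 z.2) ε⁻¹
    rw [hη.integral_one] at this
    simp only [Prod.smul_fst, Prod.smul_snd, smul_eq_mul, inv_mul_eq_div] at this
    rw [this]
    have hfr : Module.finrank ℝ (ℝ × (Fin d → ℝ)) = d + 1 := by
      simp [add_comm]
    rw [hfr, abs_of_pos (by positivity)]
    simp [hε.ne']
  have hint : Integrable fun w : ℝ × (Fin d → ℝ) => stKer d η ε w.1 w.2 := by
    by_contra h
    rw [integral_undef h] at h1
    exact zero_ne_one h1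
  refine ⟨?_⟩
  unfold auxMu
  rw [withDensity_apply _ MeasurableSet.univ, Measure.restrict_univ,
    ← ofReal_integral_eq_lintegral_ofReal hint
      (Filter.Eventually.of_forall fun w => auxKer_nonneg hη hε _ _), h1, ENNReal.ofReal_one]

theorem auxMu_supp {d : ℕ} {η : ℝ → (Fin d → ℝ) → ℝ} (hη : IsSTMollifier d η) {ε : ℝ}
    (hε : 0 < ε) : ∀ᵐ w ∂(auxMu η ε), |w.1| < ε ∧ euNorm w.2 < ε := by
  unfold auxMu
  rw [ae_withDensity_iff (auxKer_meas hη ε).measurable.ennreal_ofReal]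
  refine Filter.Eventually.of_forall fun w hw => ?_
  have h : (w.1 / ε) ^ 2 + euNorm (ε⁻¹ • w.2) ^ 2 < 1 := by
    by_contra hcon
    refine hw ?_
    simp [stKer, hη.supp _ _ (not_lt.1 hcon)]
  rw [aux_euNorm_smul, div_pow, inv_pow, inv_mul_eq_div, ← add_div, div_lt_one (by positivity)] at h
  constructor
  · refine abs_lt_of_sq_lt_sq ?_ hε.le
    nlinarith [sq_nonneg (euNorm w.2)]
  · refine lt_of_pow_lt_pow_left₀ 2 hε.le ?_
    nlinarith [sq_nonneg w.1]

theorem auxMu_mollify {d : ℕ} {η : ℝ → (Fin d → ℝ) → ℝ} (hη : IsSTMollifier d η) {ε : ℝ}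
    (hε : 0 < ε) (f : ℝ → (Fin d → ℝ) → ℝ) (t : ℝ) (x : Fin d → ℝ) :
    stMollify η ε f t x = ∫ w, f (t - w.1) (x - w.2) ∂(auxMu η ε) := by
  rw [auxMu_integral hη hε]
  unfold stMollify
  have hL : (volume : Measure (ℝ × (Fin d → ℝ))).IsAddLeftInvariant :=
    inferInstanceAs ((volume : Measure ℝ).prod (volume : Measure (Fin d → ℝ))).IsAddLeftInvariant
  have hN : (volume : Measure (ℝ × (Fin d → ℝ))).IsNegInvariant :=
    ⟨((Measure.measurePreserving_neg (volume : Measure ℝ)).prod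
      (Measure.measurePreserving_neg (volume : Measure (Fin d → ℝ)))).map_eq⟩
  have := integral_sub_left_eq_self
    (fun w : ℝ × (Fin d → ℝ) => stKer d η ε w.1 w.2 • f (t - w.1) (x - w.2)) volume (t, x)
  rw [← this]
  simp

theorem aux_fixed_time {d : ℕ} {q q₁ q₂ : ℝ≥0∞} (hq : 1 ≤ q) (hq₁ : 1 ≤ q₁) (hq₂ : 1 ≤ q₂)
    (hqq : 1 / q = 1 / q₁ + 1 / q₂) {η : ℝ → (Fin d → ℝ) → ℝ} (hη : IsSTMollifier d η) {ε : ℝ}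
    (hε : 0 < ε) {f g : ℝ → (Fin d → ℝ) → ℝ} (hf : Measurable (Function.uncurry f))
    (hg : Measurable (Function.uncurry g)) (t : ℝ) :
    eLpNorm (fun x => stMollify η ε (fun s y => f s y * g s y) t x
              - stMollify η ε f t x * stMollify η ε g t x) q (cubeVol d)
      ≤ (∫⁻ w, auxD q₁ f w t * auxD q₂ g w t ∂(auxMu η ε))
        + (∫⁻ w, auxD q₁ f w t ∂(auxMu η ε)) * ∫⁻ w, auxD q₂ g w t ∂(auxMu η ε) := by
  have := auxMu_prob hη hε
  set μ := auxMu η ε with hμ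
  have mH : ∀ {f : ℝ → (Fin d → ℝ) → ℝ}, Measurable (Function.uncurry f) →
      Measurable (Function.uncurry fun (w : ℝ × (Fin d → ℝ)) x =>
        ‖f (t - w.1) (x - w.2) - f t x‖ₑ) := by
    intro f hf
    refine Measurable.enorm (Measurable.sub ?_ ?_)
    · exact hf.comp (g := Function.uncurry f) (f := fun u : (ℝ × (Fin d → ℝ)) × (Fin d → ℝ) =>
        (t - u.1.1, u.2 - u.1.2)) (by fun_prop)
    · exact hf.comp (g := Function.uncurry f) (f := fun u : (ℝ × (Fin d → ℝ)) × (Fin d → ℝ) =>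
        (t, u.2)) (by fun_prop)
  have mS : ∀ {H : (ℝ × (Fin d → ℝ)) → (Fin d → ℝ) → ℝ≥0∞}, Measurable (Function.uncurry H) →
      Measurable fun x => ∫⁻ w, H w x ∂μ := fun hH =>
    Measurable.lintegral_prod_right' (hH.comp measurable_swap)
  have mf := mH hf
  have mg := mH hg
  have mfg : Measurable (Function.uncurry fun (w : ℝ × (Fin d → ℝ)) x =>
      ‖f (t - w.1) (x - w.2) - f t x‖ₑ * ‖g (t - w.1) (x - w.2) - g t x‖ₑ) := mf.mul mg
  calc _ ≤ eLpNorm ((fun x => ∫⁻ w, ‖f (t - w.1) (x - w.2) - f t x‖ₑ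
              * ‖g (t - w.1) (x - w.2) - g t x‖ₑ ∂μ)
            + fun x => (∫⁻ w, ‖f (t - w.1) (x - w.2) - f t x‖ₑ ∂μ)
              * ∫⁻ w, ‖g (t - w.1) (x - w.2) - g t x‖ₑ ∂μ) q (cubeVol d) := by
        refine eLpNorm_mono_enorm fun x => ?_
        rw [auxMu_mollify hη hε, auxMu_mollify hη hε, auxMu_mollify hη hε]
        simp only [enorm_eq_self, Pi.add_apply]
        exact aux_commutator μ (F := fun w => f (t - w.1) (x - w.2))
          (G := fun w => g (t - w.1) (x - w.2))
          (hf.comp (g := Function.uncurry f) (f := fun u : ℝ × (Fin d → ℝ) =>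
            (t - u.1, x - u.2)) (by fun_prop))
          (hg.comp (g := Function.uncurry g) (f := fun u : ℝ × (Fin d → ℝ) =>
            (t - u.1, x - u.2)) (by fun_prop)) (f t x) (g t x)
    _ ≤ _ := eLpNorm_add_le (mS mfg).aestronglyMeasurable
        ((mS mf).mul (mS mg)).aestronglyMeasurable hq
    _ ≤ _ := by
        refine add_le_add ?_ ?_
        · refine (aux_minkowski μ (cubeVol d) hq mfg).trans (lintegral_mono fun w => ?_)
          exact aux_holder (cubeVol d) hq hq₁ hq₂ hqq (mf.comp measurable_prodMk_left)
            (mg.comp measurable_prodMk_left)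
        · refine (aux_holder (cubeVol d) hq hq₁ hq₂ hqq (mS mf) (mS mg)).trans ?_
          exact mul_le_mul' (aux_minkowski μ (cubeVol d) hq₁ mf)
            (aux_minkowski μ (cubeVol d) hq₂ mg)

/-- **Lemma 2.3** (Constantin–E–Titi-type commutator estimate, space-time version):
for `0 < αᵢ ≤ βᵢ`, `1/p = 1/p₁ + 1/p₂`, `1/q = 1/q₁ + 1/q₂`,
`‖(fg)^ε - f^ε g^ε‖_{L^p(L^q)} ≤ C ε^{α₁+α₂}
‖f‖_{B^{β₁}_{p₁,∞}(B^{α₁}_{q₁,∞})} ‖g‖_{B^{β₂}_{p₂,∞}(B^{α₂}_{q₂,∞})}`,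
the left-hand norm being taken over the times `(ε, T-ε)` where the space-time
mollifications are defined. -/
theorem constantin_e_titi_commutator_spacetime
    (d : ℕ) (hd : 2 ≤ d) (T : ℝ) (hT : 0 < T)
    (η : ℝ → (Fin d → ℝ) → ℝ) (hη : IsSTMollifier d η)
    (α₁ α₂ β₁ β₂ : ℝ) (hα₁ : 0 < α₁) (hβ₁ : α₁ ≤ β₁) (hα₂ : 0 < α₂) (hβ₂ : α₂ ≤ β₂)
    (p q p₁ q₁ p₂ q₂ : ℝ≥0∞)
    (hp : 1 ≤ p) (hq : 1 ≤ q) (hp₁ : 1 ≤ p₁) (hq₁ : 1 ≤ q₁) (hp₂ : 1 ≤ p₂) (hq₂ : 1 ≤ q₂)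
    (hpp : 1 / p = 1 / p₁ + 1 / p₂) (hqq : 1 / q = 1 / q₁ + 1 / q₂) :
    ∃ C : ℝ≥0∞, C < ∞ ∧
      ∀ (f g : ℝ → (Fin d → ℝ) → ℝ) (ε : ℝ), 0 < ε →
        Measurable (Function.uncurry f) → Measurable (Function.uncurry g) →
        (∀ t, SpacePeriodic (f t)) → (∀ t, SpacePeriodic (g t)) →
        MemBesovBesov T β₁ p₁ α₁ q₁ f → MemBesovBesov T β₂ p₂ α₂ q₂ g →
        timeLpOn (Set.Ioo ε (T - ε)) p (fun t =>
          eLpNorm (fun x =>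
            stMollify η ε (fun s y => f s y * g s y) t x
              - stMollify η ε f t x * stMollify η ε g t x) q (cubeVol d))
          ≤ C * ENNReal.ofReal (ε ^ (α₁ + α₂))
              * besovBesovNorm T β₁ p₁ α₁ q₁ f * besovBesovNorm T β₂ p₂ α₂ q₂ g := by
  have hT0 := hT
  refine ⟨2 * (ENNReal.ofReal (1 + T ^ (β₁ - α₁)) * ENNReal.ofReal (1 + T ^ (β₂ - α₂))),
    by finiteness, ?_⟩
  intro f g ε hε hf hg _ _ _ _
  have := auxMu_prob hη hε
  set μ := auxMu η ε with hμ
  set ν : Measure ℝ := volume.restrict (Set.Ioo ε (T - ε)) with hν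
  set K₁ := ENNReal.ofReal (1 + T ^ (β₁ - α₁)) * ENNReal.ofReal (ε ^ α₁)
    * besovBesovNorm T β₁ p₁ α₁ q₁ f with hK₁
  set K₂ := ENNReal.ofReal (1 + T ^ (β₂ - α₂)) * ENNReal.ofReal (ε ^ α₂)
    * besovBesovNorm T β₂ p₂ α₂ q₂ g with hK₂
  have b₁ : ∀ᵐ w ∂μ, eLpNorm (auxD q₁ f w) p₁ ν ≤ K₁ := by
    filter_upwards [auxMu_supp hη hε] with w hw
    exact aux_shift T hα₁ hβ₁ hp₁ hq₁ hf hε hw.1 hw.2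
  have b₂ : ∀ᵐ w ∂μ, eLpNorm (auxD q₂ g w) p₂ ν ≤ K₂ := by
    filter_upwards [auxMu_supp hη hε] with w hw
    exact aux_shift T hα₂ hβ₂ hp₂ hq₂ hg hε hw.1 hw.2
  have mf := auxD_meas q₁ hf
  have mg := auxD_meas q₂ hg
  have mfg : Measurable (Function.uncurry fun w t => auxD q₁ f w t * auxD q₂ g w t) := mf.mul mg
  have mS : ∀ {H : (ℝ × (Fin d → ℝ)) → ℝ → ℝ≥0∞}, Measurable (Function.uncurry H) →
      Measurable fun t => ∫⁻ w, H w t ∂μ := fun hH =>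
    Measurable.lintegral_prod_right' (hH.comp measurable_swap)
  have cst : ∀ K : ℝ≥0∞, ∫⁻ _, K ∂μ = K := fun K => by simp
  rw [aux_timeLpOn _ hp]
  calc _ ≤ eLpNorm ((fun t => ∫⁻ w, auxD q₁ f w t * auxD q₂ g w t ∂μ)
        + fun t => (∫⁻ w, auxD q₁ f w t ∂μ) * ∫⁻ w, auxD q₂ g w t ∂μ) p ν := by
        refine eLpNorm_mono_enorm fun t => ?_
        simp only [enorm_eq_self, Pi.add_apply]
        exact aux_fixed_time hq hq₁ hq₂ hqq hη hε hf hg t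
    _ ≤ _ := eLpNorm_add_le (mS mfg).aestronglyMeasurable
        ((mS mf).mul (mS mg)).aestronglyMeasurable hp
    _ ≤ K₁ * K₂ + K₁ * K₂ := by
        refine add_le_add ?_ ?_
        · refine (aux_minkowski μ ν hp mfg).trans ?_
          rw [← cst (K₁ * K₂)]
          refine lintegral_mono_ae ?_
          filter_upwards [b₁, b₂] with w h1 h2
          exact (aux_holder ν hp hp₁ hp₂ hpp (mf.comp measurable_prodMk_left)
            (mg.comp measurable_prodMk_left)).trans (mul_le_mul' h1 h2)
        · refine (aux_holder ν hp hp₁ hp₂ hpp (mS mf) (mS mg)).trans (mul_le_mul' ?_ ?_)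
          · refine (aux_minkowski μ ν hp₁ mf).trans ?_
            rw [← cst K₁]
            exact lintegral_mono_ae b₁
          · refine (aux_minkowski μ ν hp₂ mg).trans ?_
            rw [← cst K₂]
            exact lintegral_mono_ae b₂
    _ = _ := by
        rw [hK₁, hK₂, Real.rpow_add hε, ENNReal.ofReal_mul (by positivity)]
        ring

end CompressibleEuler
end
end

section
/- Let d≥2 and p,q,p₁,q₁,p₂,q₂ ∈ [1,∞) with 1/p = 1/p₁ + 1/p₂ and 1/q = 1/q₁ + 1/q₂. If f ∈ L^{p₁}(0,T;L^{q₁}(𝕋^d)) and g ∈ L^{p₂}(0,T;L^{q₂}(𝕋^d)), then ‖(fg)^ε − f^ε g^ε‖_{L^p(0,T;L^q(𝕋^d))} → 0 as ε → 0, where f^ε, g^ε, (fg)^ε denote mollification in the space variable. -/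
open MeasureTheory ENNReal

noncomputable section

namespace CompressibleEuler

variable {d : ℕ} {E : Type*} [NormedAddCommGroup E]

lemma continuous_euNorm : Continuous (euNorm : (Fin d → ℝ) → ℝ) := by
  unfold euNorm
  fun_prop

lemma abs_le_euNorm (x : Fin d → ℝ) (i : Fin d) : |x i| ≤ euNorm x := by
  unfold euNorm
  apply Real.abs_le_sqrt
  exact Finset.single_le_sum (f := fun i => x i ^ 2) (fun i _ => sq_nonneg _) (Finset.mem_univ i)

lemma norm_le_euNorm (x : Fin d → ℝ) : ‖x‖ ≤ euNorm x := by
  have h0 : 0 ≤ euNorm x := Real.sqrt_nonneg _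
  rw [pi_norm_le_iff_of_nonneg h0]
  exact fun i => abs_le_euNorm x i

lemma bump_nonneg (x : Fin d → ℝ) : 0 ≤ bump d x := by
  unfold bump
  split_ifs <;> positivity

lemma bump_le_one (x : Fin d → ℝ) : bump d x ≤ 1 := by
  unfold bump
  split_ifs with h
  · have h0 : 0 ≤ euNorm x := Real.sqrt_nonneg _
    apply Real.exp_le_one_iff.2
    rw [neg_nonpos, inv_nonneg]
    nlinarith
  · exact zero_le_one

lemma norm_le_of_bump_ne {x : Fin d → ℝ} (h : bump d x ≠ 0) : ‖x‖ ≤ 1 := by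
  by_contra hx
  apply h
  unfold bump
  rw [if_neg]
  have := norm_le_euNorm x
  linarith

lemma measurable_bump : Measurable (bump d) := by
  unfold bump
  have h : Measurable (euNorm : (Fin d → ℝ) → ℝ) := continuous_euNorm.measurable
  refine Measurable.ite (measurableSet_lt h measurable_const) ?_ measurable_const
  fun_prop

lemma integrable_bump : Integrable (bump d) volume := by
  have h : Integrable ((Metric.closedBall (0 : Fin d → ℝ) 1).indicator (fun _ => (1:ℝ))) volume := by
    rw [integrable_indicator_iff measurableSet_closedBall]
    exact integrableOn_const (isCompact_closedBall _ _).measure_lt_top.ne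
  refine h.mono' measurable_bump.aestronglyMeasurable (ae_of_all _ fun x => ?_)
  rw [Real.norm_of_nonneg (bump_nonneg x)]
  by_cases hx : x ∈ Metric.closedBall (0 : Fin d → ℝ) 1
  · rw [Set.indicator_of_mem hx]; exact bump_le_one x
  · rw [Set.indicator_of_notMem hx]
    by_contra hb
    apply hx
    rw [mem_closedBall_zero_iff]
    exact norm_le_of_bump_ne (fun h => hb h.le)

lemma integral_bump_pos : 0 < ∫ x : Fin d → ℝ, bump d x := by
  rw [integral_pos_iff_support_of_nonneg (fun x => bump_nonneg x) integrable_bump]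
  have ho : IsOpen {x : Fin d → ℝ | euNorm x < 1} := isOpen_lt continuous_euNorm continuous_const
  have hne : ({x : Fin d → ℝ | euNorm x < 1}).Nonempty := ⟨0, by simp [euNorm]⟩
  refine (ho.measure_pos volume hne).trans_le (measure_mono fun x hx => ?_)
  rw [Set.mem_ofPred_eq] at hx
  rw [Function.mem_support, bump, if_pos hx]
  positivity

lemma bumpConst_pos : 0 < bumpConst d := inv_pos.2 integral_bump_pos

lemma sKer_nonneg {ε : ℝ} (hε : 0 < ε) (x : Fin d → ℝ) : 0 ≤ sKer d ε x := by
  unfold sKer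
  have := bump_nonneg (ε⁻¹ • x)
  have := bumpConst_pos (d := d)
  positivity

lemma measurable_sKer (ε : ℝ) : Measurable (sKer d ε) := by
  unfold sKer
  have := measurable_bump (d := d)
  fun_prop

lemma sKer_le {ε : ℝ} (hε : 0 < ε) (x : Fin d → ℝ) : sKer d ε x ≤ (ε ^ d)⁻¹ * bumpConst d := by
  unfold sKer
  have := bump_le_one (ε⁻¹ • x)
  have := bumpConst_pos (d := d)
  gcongr
  nlinarith

lemma norm_le_of_sKer_ne {ε : ℝ} (hε : 0 < ε) {x : Fin d → ℝ} (h : sKer d ε x ≠ 0) : ‖x‖ ≤ ε := by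
  have h1 : bump d (ε⁻¹ • x) ≠ 0 := by
    intro h0
    apply h
    simp [sKer, h0]
  have h2 := norm_le_of_bump_ne h1
  rw [norm_smul, norm_inv, Real.norm_of_nonneg hε.le, inv_mul_le_iff₀ hε] at h2
  linarith

lemma integral_sKer {ε : ℝ} (hε : 0 < ε) : ∫ x : Fin d → ℝ, sKer d ε x = 1 := by
  unfold sKer
  rw [integral_const_mul, integral_const_mul, Measure.integral_comp_inv_smul_of_nonneg _ _ hε.le]
  have h := integral_bump_pos (d := d)
  simp only [Module.finrank_fintype_fun_eq_card, Fintype.card_fin, smul_eq_mul, bumpConst]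
  have : ε ^ d ≠ 0 := by positivity
  field_simp

lemma integrable_sKer {ε : ℝ} (hε : 0 < ε) : Integrable (sKer d ε) volume := by
  by_contra h
  have := integral_sKer (d := d) hε
  rw [integral_undef h] at this
  exact zero_ne_one this

/-- The mollifier as a measure. -/
def molMeas (d : ℕ) (ε : ℝ) : Measure (Fin d → ℝ) :=
  volume.withDensity fun x => ENNReal.ofReal (sKer d ε x)

lemma isProb_molMeas {ε : ℝ} (hε : 0 < ε) : IsProbabilityMeasure (molMeas d ε) := by
  constructor
  rw [molMeas, withDensity_apply _ MeasurableSet.univ, Measure.restrict_univ,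
    ← ofReal_integral_eq_lintegral_ofReal (integrable_sKer hε)
      (ae_of_all _ fun x => sKer_nonneg hε x), integral_sKer hε, ENNReal.ofReal_one]

lemma molMeas_ae {ε : ℝ} (hε : 0 < ε) : ∀ᵐ y ∂(molMeas d ε), ‖y‖ ≤ ε := by
  rw [molMeas, ae_withDensity_iff (measurable_sKer ε).ennreal_ofReal]
  refine ae_of_all _ fun x hx => norm_le_of_sKer_ne hε fun h => hx ?_
  rw [h, ENNReal.ofReal_zero]

lemma integrable_molMeas {ε : ℝ} (hε : 0 < ε) {u : (Fin d → ℝ) → ℝ} (hu : Integrable u volume) :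
    Integrable u (molMeas d ε) := by
  have h : molMeas d ε ≤ ENNReal.ofReal ((ε ^ d)⁻¹ * bumpConst d) • volume := by
    rw [← withDensity_const, molMeas]
    exact withDensity_mono (ae_of_all _ fun x => ENNReal.ofReal_le_ofReal (sKer_le hε x))
  exact (hu.smul_measure ENNReal.ofReal_ne_top).mono_measure h

lemma sMollify_eq {ε : ℝ} (hε : 0 < ε) (u : (Fin d → ℝ) → ℝ) (x : Fin d → ℝ) :
    sMollify ε u x = ∫ y, u (x - y) ∂(molMeas d ε) := by
  rw [molMeas, integral_withDensity_eq_integral_toReal_smul (measurable_sKer ε).ennreal_ofReal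
    (ae_of_all _ fun _ => ENNReal.ofReal_lt_top), sMollify,
    ← integral_sub_left_eq_self (fun y => sKer d ε (x - y) • u y) volume x]
  refine integral_congr_ae (ae_of_all _ fun y => ?_)
  have h : x - (x - y) = y := by simp
  simp only
  rw [h, ENNReal.toReal_ofReal (sKer_nonneg hε y)]

lemma jensen_lintegral {X Y : Type*} [MeasurableSpace X] [MeasurableSpace Y]
    (ν : Measure Y) [IsProbabilityMeasure ν]
    (μ : Measure X) [SFinite μ] (F : X → Y → ℝ) (hF : Measurable (Function.uncurry F))
    {r : ℝ} (hr : 1 ≤ r) :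
    ∫⁻ x, ‖∫ y, F x y ∂ν‖ₑ ^ r ∂μ ≤ ∫⁻ y, ∫⁻ x, ‖F x y‖ₑ ^ r ∂μ ∂ν := by
  have hr0 : 0 < r := by linarith
  have hsw : ∫⁻ x, ∫⁻ y, ‖F x y‖ₑ ^ r ∂ν ∂μ = ∫⁻ y, ∫⁻ x, ‖F x y‖ₑ ^ r ∂μ ∂ν :=
    lintegral_lintegral_swap (hF.enorm.pow_const r).aemeasurable
  rw [← hsw]
  refine lintegral_mono fun x => ?_
  have hm : Measurable (F x) := hF.of_uncurry_left
  have h1 := eLpNorm_le_eLpNorm_of_exponent_le (μ := ν) (p := 1) (q := ENNReal.ofReal r)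
    (by simpa using hr) hm.aestronglyMeasurable
  rw [eLpNorm_one_eq_lintegral_enorm, eLpNorm_eq_lintegral_rpow_enorm_toReal
    (by simpa using hr0) ENNReal.ofReal_ne_top, ENNReal.toReal_ofReal hr0.le] at h1
  have h2 := (enorm_integral_le_lintegral_enorm (μ := ν) (F x)).trans h1
  calc ‖∫ y, F x y ∂ν‖ₑ ^ r ≤ ((∫⁻ y, ‖F x y‖ₑ ^ r ∂ν) ^ (1 / r)) ^ r :=
        ENNReal.rpow_le_rpow h2 hr0.le
    _ = _ := by
        rw [← ENNReal.rpow_mul, one_div, inv_mul_cancel₀ hr0.ne', ENNReal.rpow_one]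

/-- The enlarged cube. -/
def bigCube (d : ℕ) : Set (Fin d → ℝ) := Set.univ.pi fun _ => Set.Ico (-1 : ℝ) 2

lemma measurableSet_unitCube : MeasurableSet (unitCube d) :=
  MeasurableSet.univ_pi fun _ => measurableSet_Ico

lemma measurableSet_bigCube : MeasurableSet (bigCube d) :=
  MeasurableSet.univ_pi fun _ => measurableSet_Ico

lemma unitCube_sub_mem {x y : Fin d → ℝ} (hx : x ∈ unitCube d) (hy : ‖y‖ ≤ 1) :
    x - y ∈ bigCube d := by
  intro i _
  have h1 := hx i (Set.mem_univ i)
  have h2 : |y i| ≤ 1 := (norm_le_pi_norm y i).trans hy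
  rw [abs_le] at h2
  simp only [Set.mem_Ico, Pi.sub_apply] at *
  constructor <;> linarith

lemma unitCube_subset : unitCube d ⊆ bigCube d := by
  intro x hx
  simpa using unitCube_sub_mem hx (y := 0) (by simp)

/-- Cut-off of a periodic function to the enlarged cube. -/
def cut (φ : (Fin d → ℝ) → ℝ) : (Fin d → ℝ) → ℝ := (bigCube d).indicator φ

lemma measurable_cut {φ : (Fin d → ℝ) → ℝ} (h : Measurable φ) : Measurable (cut φ) :=
  h.indicator measurableSet_bigCube

lemma lintegral_shift (G : (Fin d → ℝ) → ℝ≥0∞)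
    (hG : ∀ (x : Fin d → ℝ) (n : Fin d → ℤ), G (x + fun i => (n i : ℝ)) = G x) (n : Fin d → ℤ) :
    ∫⁻ x in {x | (x - fun i => (n i : ℝ)) ∈ unitCube d}, G x = ∫⁻ x in unitCube d, G x := by
  have hm : MeasurableSet {x : Fin d → ℝ | (x - fun i => (n i : ℝ)) ∈ unitCube d} :=
    (measurable_id.sub_const _) measurableSet_unitCube
  rw [← lintegral_indicator hm, ← lintegral_indicator measurableSet_unitCube,
    ← lintegral_sub_right_eq_self ((unitCube d).indicator G) (fun i => (n i : ℝ))]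
  refine lintegral_congr fun x => ?_
  have h := hG (x - fun i => (n i : ℝ)) n
  rw [sub_add_cancel] at h
  by_cases hx : (x - fun i => (n i : ℝ)) ∈ unitCube d
  · rw [Set.indicator_of_mem hx, Set.indicator_of_mem (by exact hx), h]
  · rw [Set.indicator_of_notMem hx, Set.indicator_of_notMem (by exact hx)]

lemma bigCube_subset : bigCube d ⊆
    ⋃ n : Fin d → Fin 3, {x | (x - fun i => ((((n i : ℕ) : ℤ) - 1 : ℤ) : ℝ)) ∈ unitCube d} := by
  intro x hx
  have : ∀ i, ∃ k : Fin 3, x i - ((((k : ℕ) : ℤ) - 1 : ℤ) : ℝ) ∈ Set.Ico (0:ℝ) 1 := by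
    intro i
    have h := hx i (Set.mem_univ i)
    simp only [Set.mem_Ico] at h
    by_cases h0 : x i < 0
    · exact ⟨0, by constructor <;> simp <;> linarith⟩
    · by_cases h1 : x i < 1
      · exact ⟨1, by constructor <;> simp <;> linarith⟩
      · exact ⟨2, by constructor <;> norm_num <;> linarith⟩
  choose n hn using this
  exact Set.mem_iUnion.2 ⟨n, fun i _ => hn i⟩

lemma lintegral_cut {φ : (Fin d → ℝ) → ℝ} (hper : SpacePeriodic φ) {r : ℝ} (hr : 0 < r) :
    ∫⁻ x, ‖cut φ x‖ₑ ^ r ≤ 3 ^ d * ∫⁻ x, ‖φ x‖ₑ ^ r ∂(cubeVol d) := by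
  have h1 : ∀ x, ‖cut φ x‖ₑ ^ r = (bigCube d).indicator (fun x => ‖φ x‖ₑ ^ r) x := by
    intro x
    by_cases hx : x ∈ bigCube d
    · simp [cut, hx]
    · simp [cut, hx, hr]
  simp_rw [h1]
  rw [lintegral_indicator measurableSet_bigCube]
  calc ∫⁻ x in bigCube d, ‖φ x‖ₑ ^ r
      ≤ ∫⁻ x in ⋃ n : Fin d → Fin 3,
          {x | (x - fun i => ((((n i : ℕ) : ℤ) - 1 : ℤ) : ℝ)) ∈ unitCube d}, ‖φ x‖ₑ ^ r :=
        lintegral_mono_set bigCube_subset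
    _ ≤ ∑' n : Fin d → Fin 3, ∫⁻ x in
          {x | (x - fun i => ((((n i : ℕ) : ℤ) - 1 : ℤ) : ℝ)) ∈ unitCube d}, ‖φ x‖ₑ ^ r :=
        lintegral_iUnion_le _ _
    _ = ∑' n : Fin d → Fin 3, ∫⁻ x in unitCube d, ‖φ x‖ₑ ^ r := by
        congr 1
        ext n
        exact lintegral_shift (fun x => ‖φ x‖ₑ ^ r) (fun x m => by rw [hper x m])
          (fun i => ((n i : ℕ) : ℤ) - 1)
    _ = 3 ^ d * ∫⁻ x, ‖φ x‖ₑ ^ r ∂(cubeVol d) := by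
        rw [tsum_fintype, Finset.sum_const, cubeVol]
        simp

lemma sMollify_cut {ε : ℝ} (hε : 0 < ε) (hε1 : ε ≤ 1) (φ : (Fin d → ℝ) → ℝ) {x : Fin d → ℝ}
    (hx : x ∈ unitCube d) : sMollify ε φ x = sMollify ε (cut φ) x := by
  rw [sMollify_eq hε, sMollify_eq hε]
  refine integral_congr_ae ?_
  filter_upwards [molMeas_ae (d := d) hε] with y hy
  rw [cut, Set.indicator_of_mem (unitCube_sub_mem hx (hy.trans hε1))]

lemma lintegral_mollify_le {ε : ℝ} (hε : 0 < ε) (hε1 : ε ≤ 1) {φ : (Fin d → ℝ) → ℝ}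
    (hφ : Measurable φ) (hper : SpacePeriodic φ) {r : ℝ} (hr : 1 ≤ r) :
    ∫⁻ x, ‖sMollify ε φ x‖ₑ ^ r ∂(cubeVol d) ≤ 3 ^ d * ∫⁻ x, ‖φ x‖ₑ ^ r ∂(cubeVol d) := by
  have := isProb_molMeas (d := d) hε
  have hψ := measurable_cut hφ
  calc ∫⁻ x, ‖sMollify ε φ x‖ₑ ^ r ∂(cubeVol d)
      = ∫⁻ x, ‖∫ y, cut φ (x - y) ∂(molMeas d ε)‖ₑ ^ r ∂(cubeVol d) := by
        refine setLIntegral_congr_fun measurableSet_unitCube fun x hx => ?_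
        rw [sMollify_cut hε hε1 φ hx, sMollify_eq hε]
    _ ≤ ∫⁻ x, ‖∫ y, cut φ (x - y) ∂(molMeas d ε)‖ₑ ^ r := setLIntegral_le_lintegral _ _
    _ ≤ ∫⁻ y, ∫⁻ x, ‖cut φ (x - y)‖ₑ ^ r ∂volume ∂(molMeas d ε) :=
        jensen_lintegral _ _ (fun x y => cut φ (x - y)) (hψ.comp measurable_sub) hr
    _ = ∫⁻ x, ‖cut φ x‖ₑ ^ r := by
        have : ∀ y, ∫⁻ x, ‖cut φ (x - y)‖ₑ ^ r = ∫⁻ x, ‖cut φ x‖ₑ ^ r := fun y =>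
          lintegral_sub_right_eq_self (fun x => ‖cut φ x‖ₑ ^ r) y
        simp_rw [this]
        simp
    _ ≤ _ := lintegral_cut hper (by linarith)

lemma translation_cont {ψ : (Fin d → ℝ) → ℝ} {p : ℝ≥0∞} (hp1 : 1 ≤ p) (hp : p ≠ ∞)
    (hψ : MemLp ψ p volume) :
    Filter.Tendsto (fun y => eLpNorm (fun x => ψ (x - y) - ψ x) p volume) (nhds 0) (nhds 0) := by
  have : Fact (1 ≤ p) := ⟨hp1⟩
  have : Fact (p ≠ ∞) := ⟨hp⟩
  have hc : Continuous fun y : Fin d → ℝ => edist (DomAddAct.mk (-y) +ᵥ hψ.toLp ψ) (hψ.toLp ψ) := by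
    refine Continuous.edist ?_ continuous_const
    exact (DomAddAct.continuous_mk.comp continuous_neg).vadd continuous_const
  have h0 := hc.tendsto 0
  simp only [neg_zero, DomAddAct.mk_zero, zero_vadd, edist_self] at h0
  refine h0.congr fun y => ?_
  rw [DomAddAct.mk_vadd_toLp, Lp.edist_toLp_toLp]
  refine eLpNorm_congr_ae (ae_of_all _ fun x => ?_)
  simp [sub_eq_neg_add, add_comm]

lemma eLpNorm_ofReal {X : Type*} [MeasurableSpace X] (μ : Measure X) (u : X → ℝ) {r : ℝ}
    (hr : 1 ≤ r) : eLpNorm u (ENNReal.ofReal r) μ = (∫⁻ x, ‖u x‖ₑ ^ r ∂μ) ^ (1 / r) := by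
  have hr0 : 0 < r := by linarith
  rw [eLpNorm_eq_lintegral_rpow_enorm_toReal
    (by simpa using hr0) ENNReal.ofReal_ne_top, ENNReal.toReal_ofReal hr0.le]

lemma three_pow_rpow_le {r : ℝ} (hr : 1 ≤ r) : ((3 : ℝ≥0∞) ^ d) ^ (1 / r) ≤ 3 ^ d := by
  calc ((3 : ℝ≥0∞) ^ d) ^ (1 / r) ≤ ((3 : ℝ≥0∞) ^ d) ^ (1 : ℝ) := by
        apply ENNReal.rpow_le_rpow_of_exponent_le
        · exact one_le_pow₀ (by norm_num)
        · rw [div_le_one (by linarith)]; exact hr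
    _ = 3 ^ d := ENNReal.rpow_one _

lemma eLpNorm_le_of_lintegral {X Y : Type*} [MeasurableSpace X] [MeasurableSpace Y]
    {μ : Measure X} {ν : Measure Y} {u : X → ℝ} {v : Y → ℝ} {r : ℝ} (hr : 1 ≤ r)
    (h : ∫⁻ x, ‖u x‖ₑ ^ r ∂μ ≤ 3 ^ d * ∫⁻ x, ‖v x‖ₑ ^ r ∂ν) :
    eLpNorm u (ENNReal.ofReal r) μ ≤ 3 ^ d * eLpNorm v (ENNReal.ofReal r) ν := by
  have hr0 : 0 ≤ 1 / r := by positivity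
  rw [eLpNorm_ofReal _ _ hr, eLpNorm_ofReal _ _ hr]
  refine (ENNReal.rpow_le_rpow h hr0).trans ?_
  rw [ENNReal.mul_rpow_of_nonneg _ _ hr0]
  gcongr
  exact three_pow_rpow_le hr

lemma eLpNorm_mollify_le {ε : ℝ} (hε : 0 < ε) (hε1 : ε ≤ 1) {φ : (Fin d → ℝ) → ℝ}
    (hφ : Measurable φ) (hper : SpacePeriodic φ) {r : ℝ} (hr : 1 ≤ r) :
    eLpNorm (sMollify ε φ) (ENNReal.ofReal r) (cubeVol d)
      ≤ 3 ^ d * eLpNorm φ (ENNReal.ofReal r) (cubeVol d) :=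
  eLpNorm_le_of_lintegral hr (lintegral_mollify_le hε hε1 hφ hper hr)

lemma memLp_cut {φ : (Fin d → ℝ) → ℝ}
    (hφ : Measurable φ) (hper : SpacePeriodic φ) {r : ℝ} (hr : 1 ≤ r)
    (hfin : eLpNorm φ (ENNReal.ofReal r) (cubeVol d) < ∞) :
    MemLp (cut φ) (ENNReal.ofReal r) volume := by
  refine ⟨(measurable_cut hφ).aestronglyMeasurable, ?_⟩
  refine (eLpNorm_le_of_lintegral (d := d) hr (lintegral_cut hper (by linarith))).trans_lt ?_
  exact ENNReal.mul_lt_top (by simp) hfin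

lemma integrable_cut {φ : (Fin d → ℝ) → ℝ}
    (hφ : Measurable φ) (hper : SpacePeriodic φ) {r : ℝ} (hr : 1 ≤ r)
    (hfin : eLpNorm φ (ENNReal.ofReal r) (cubeVol d) < ∞) :
    Integrable (cut φ) volume := by
  have hfm : IsFiniteMeasure (cubeVol d) := by
    constructor
    rw [cubeVol, Measure.restrict_apply_univ, unitCube, Real.volume_pi_Ico]
    simp
  have h1 : MemLp φ (ENNReal.ofReal r) (cubeVol d) := ⟨hφ.aestronglyMeasurable, hfin⟩
  have h2 : MemLp φ (ENNReal.ofReal 1) (cubeVol d) :=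
    h1.mono_exponent (ENNReal.ofReal_le_ofReal hr)
  have h3 := memLp_cut hφ hper le_rfl h2.2
  rwa [ENNReal.ofReal_one, memLp_one_iff_integrable] at h3

lemma mollify_tendsto {φ : (Fin d → ℝ) → ℝ}
    (hφ : Measurable φ) (hper : SpacePeriodic φ) {r : ℝ} (hr : 1 ≤ r)
    (hfin : eLpNorm φ (ENNReal.ofReal r) (cubeVol d) < ∞) :
    Filter.Tendsto (fun ε : ℝ =>
      eLpNorm (fun x => sMollify ε φ x - φ x) (ENNReal.ofReal r) (cubeVol d))
      (nhdsWithin 0 (Set.Ioi 0)) (nhds 0) := by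
  have hr0 : 0 < r := by linarith
  have hψm := measurable_cut hφ
  have hψ := memLp_cut hφ hper hr hfin
  have hψi := integrable_cut hφ hper hr hfin
  have ht := translation_cont (by simpa using hr) ENNReal.ofReal_ne_top hψ
  rw [ENNReal.tendsto_nhds_zero] at ht ⊢
  intro δ hδ
  obtain ⟨ρ, hρ, hball⟩ := Metric.eventually_nhds_iff.1 (ht δ hδ)
  have hev : Set.Ioo (0:ℝ) (min ρ 1) ∈ nhdsWithin (0:ℝ) (Set.Ioi 0) :=
    Ioo_mem_nhdsGT (by positivity)
  filter_upwards [hev] with ε hεm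
  have hε : 0 < ε := hεm.1
  have hερ : ε < ρ := hεm.2.trans_le (min_le_left _ _)
  have hε1 : ε ≤ 1 := (hεm.2.trans_le (min_le_right _ _)).le
  have := isProb_molMeas (d := d) hε
  have key : ∫⁻ x, ‖sMollify ε φ x - φ x‖ₑ ^ r ∂(cubeVol d) ≤ δ ^ r := by
    calc ∫⁻ x, ‖sMollify ε φ x - φ x‖ₑ ^ r ∂(cubeVol d)
        = ∫⁻ x, ‖∫ y, (cut φ (x - y) - cut φ x) ∂(molMeas d ε)‖ₑ ^ r ∂(cubeVol d) := by
          refine setLIntegral_congr_fun measurableSet_unitCube fun x hx => ?_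
          have hi : Integrable (fun y => cut φ (x - y)) (molMeas d ε) :=
            integrable_molMeas hε (hψi.comp_sub_left x)
          rw [sMollify_cut hε hε1 φ hx, sMollify_eq hε, integral_sub hi (integrable_const _),
            integral_const]
          simp [cut, unitCube_subset hx]
      _ ≤ ∫⁻ x, ‖∫ y, (cut φ (x - y) - cut φ x) ∂(molMeas d ε)‖ₑ ^ r :=
          setLIntegral_le_lintegral _ _
      _ ≤ ∫⁻ y, ∫⁻ x, ‖cut φ (x - y) - cut φ x‖ₑ ^ r ∂volume ∂(molMeas d ε) :=
          jensen_lintegral _ _ (fun x y => cut φ (x - y) - cut φ x)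
            ((hψm.comp measurable_sub).sub (hψm.comp measurable_fst)) hr
      _ ≤ ∫⁻ y, δ ^ r ∂(molMeas d ε) := by
          refine lintegral_mono_ae ?_
          filter_upwards [molMeas_ae (d := d) hε] with y hy
          have h := hball (y := y) (by rw [dist_zero_right]; linarith)
          rw [eLpNorm_ofReal _ _ hr] at h
          have h' := ENNReal.rpow_le_rpow h hr0.le
          rwa [← ENNReal.rpow_mul, one_div, inv_mul_cancel₀ hr0.ne', ENNReal.rpow_one] at h'
      _ = δ ^ r := by simp
  rw [eLpNorm_ofReal _ _ hr]
  refine (ENNReal.rpow_le_rpow key (by positivity)).trans ?_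
  rw [← ENNReal.rpow_mul, one_div, mul_inv_cancel₀ hr0.ne', ENNReal.rpow_one]

lemma measurable_sMollify_uncurry {X : Type*} [MeasurableSpace X] (ε : ℝ) {f : X → (Fin d → ℝ) → ℝ}
    (hf : Measurable (Function.uncurry f)) :
    Measurable fun z : X × (Fin d → ℝ) => sMollify ε (f z.1) z.2 := by
  unfold sMollify
  have h : StronglyMeasurable (Function.uncurry
      fun (z : X × (Fin d → ℝ)) (y : Fin d → ℝ) => sKer d ε (z.2 - y) • f z.1 y) := by
    apply Measurable.stronglyMeasurable
    have hk := measurable_sKer (d := d) ε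
    have h1 : Measurable fun w : (X × (Fin d → ℝ)) × (Fin d → ℝ) => sKer d ε (w.1.2 - w.2) :=
      hk.comp ((measurable_snd.comp measurable_fst).sub measurable_snd)
    have h2 : Measurable fun w : (X × (Fin d → ℝ)) × (Fin d → ℝ) => f w.1.1 w.2 :=
      hf.comp ((measurable_fst.comp measurable_fst).prodMk measurable_snd)
    exact h1.mul h2
  exact (h.integral_prod_right (ν := volume)).measurable

lemma measurable_sMollify (ε : ℝ) {φ : (Fin d → ℝ) → ℝ} (hφ : Measurable φ) :
    Measurable (sMollify ε φ) := by
  have hf : Measurable (Function.uncurry fun (_ : Unit) => φ) := by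
    have h : Measurable fun z : Unit × (Fin d → ℝ) => φ z.2 := hφ.comp measurable_snd
    exact h
  have h := measurable_sMollify_uncurry ε hf
  have h2 : Measurable fun x : Fin d → ℝ => ((), x) := measurable_const.prodMk measurable_id
  have h3 := h.comp h2
  simpa only [Function.comp_def] using h3

lemma measurable_eLpNorm_cube {r : ℝ} (hr : 1 ≤ r) {F : ℝ → (Fin d → ℝ) → ℝ}
    (hF : Measurable (Function.uncurry F)) :
    Measurable fun t => eLpNorm (F t) (ENNReal.ofReal r) (cubeVol d) := by
  have hsf : SFinite (cubeVol d) := by unfold cubeVol; infer_instance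
  simp_rw [eLpNorm_ofReal _ _ hr]
  exact (Measurable.lintegral_prod_right' (hF.enorm.pow_const r)).pow_const _

lemma holder_cube {q q₁ q₂ : ℝ} (hq : 1 ≤ q) (hq₁ : 1 ≤ q₁) (hq₂ : 1 ≤ q₂)
    (hqq : 1 / q = 1 / q₁ + 1 / q₂) {u v : (Fin d → ℝ) → ℝ} (hu : Measurable u)
    (hv : Measurable v) :
    eLpNorm (fun x => u x * v x) (ENNReal.ofReal q) (cubeVol d) ≤
      eLpNorm u (ENNReal.ofReal q₁) (cubeVol d) * eLpNorm v (ENNReal.ofReal q₂) (cubeVol d) := by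
  have : ENNReal.HolderTriple (ENNReal.ofReal q₁) (ENNReal.ofReal q₂) (ENNReal.ofReal q) := by
    constructor
    rw [← ENNReal.ofReal_inv_of_pos (by linarith), ← ENNReal.ofReal_inv_of_pos (by linarith),
      ← ENNReal.ofReal_inv_of_pos (by linarith),
      ← ENNReal.ofReal_add (by positivity) (by positivity)]
    simp only [one_div] at hqq
    rw [hqq]
  have h := eLpNorm_smul_le_mul_eLpNorm (p := ENNReal.ofReal q₁) (q := ENNReal.ofReal q₂)
    (r := ENNReal.ofReal q) (μ := cubeVol d) (f := v) (φ := u)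
    hv.aestronglyMeasurable hu.aestronglyMeasurable
  have e : (fun x => u x * v x) = u • v := by
    ext x
    simp
  rw [e]
  exact h

lemma commutator_bound {q q₁ q₂ : ℝ} (hq : 1 ≤ q) (hq₁ : 1 ≤ q₁) (hq₂ : 1 ≤ q₂)
    (hqq : 1 / q = 1 / q₁ + 1 / q₂) {u v : (Fin d → ℝ) → ℝ} (hu : Measurable u)
    (hv : Measurable v) (hup : SpacePeriodic u) (hvp : SpacePeriodic v)
    {ε : ℝ} (hε : 0 < ε) (hε1 : ε ≤ 1) :
    eLpNorm (fun x => sMollify ε (fun y => u y * v y) x - sMollify ε u x * sMollify ε v x)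
      (ENNReal.ofReal q) (cubeVol d) ≤ (3 ^ d + 3 ^ d * 3 ^ d) *
      (eLpNorm u (ENNReal.ofReal q₁) (cubeVol d) * eLpNorm v (ENNReal.ofReal q₂) (cubeVol d)) := by
  have huv : Measurable fun y => u y * v y := hu.mul hv
  have huvp : SpacePeriodic fun y => u y * v y := fun x n => by
    simp only [hup x n, hvp x n]
  have mu := measurable_sMollify ε hu
  have mv := measurable_sMollify ε hv
  have muv := measurable_sMollify ε huv
  refine (eLpNorm_sub_le muv.aestronglyMeasurable (mu.mul mv).aestronglyMeasurable
    (by simpa using hq)).trans ?_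
  rw [add_mul]
  refine add_le_add ?_ ?_
  · refine (eLpNorm_mollify_le hε hε1 huv huvp hq).trans ?_
    gcongr
    exact holder_cube hq hq₁ hq₂ hqq hu hv
  · refine (holder_cube hq hq₁ hq₂ hqq mu mv).trans ?_
    calc _ ≤ (3 ^ d * eLpNorm u (ENNReal.ofReal q₁) (cubeVol d)) *
          (3 ^ d * eLpNorm v (ENNReal.ofReal q₂) (cubeVol d)) :=
          mul_le_mul' (eLpNorm_mollify_le hε hε1 hu hup hq₁) (eLpNorm_mollify_le hε hε1 hv hvp hq₂)
      _ = _ := by ring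

lemma commutator_tendsto {q q₁ q₂ : ℝ} (hq : 1 ≤ q) (hq₁ : 1 ≤ q₁) (hq₂ : 1 ≤ q₂)
    (hqq : 1 / q = 1 / q₁ + 1 / q₂) {u v : (Fin d → ℝ) → ℝ} (hu : Measurable u)
    (hv : Measurable v) (hup : SpacePeriodic u) (hvp : SpacePeriodic v)
    (huf : eLpNorm u (ENNReal.ofReal q₁) (cubeVol d) < ∞)
    (hvf : eLpNorm v (ENNReal.ofReal q₂) (cubeVol d) < ∞) :
    Filter.Tendsto (fun ε : ℝ =>
      eLpNorm (fun x => sMollify ε (fun y => u y * v y) x - sMollify ε u x * sMollify ε v x)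
      (ENNReal.ofReal q) (cubeVol d)) (nhdsWithin 0 (Set.Ioi 0)) (nhds 0) := by
  have huv : Measurable fun y => u y * v y := hu.mul hv
  have huvp : SpacePeriodic fun y => u y * v y := fun x n => by
    simp only [hup x n, hvp x n]
  have huvf : eLpNorm (fun y => u y * v y) (ENNReal.ofReal q) (cubeVol d) < ∞ :=
    (holder_cube hq hq₁ hq₂ hqq hu hv).trans_lt (ENNReal.mul_lt_top huf hvf)
  have tu := mollify_tendsto hu hup hq₁ huf
  have tv := mollify_tendsto hv hvp hq₂ hvf
  have tuv := mollify_tendsto huv huvp hq huvf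
  have hlim := (tuv.add (ENNReal.Tendsto.const_mul (a := 3 ^ d * eLpNorm u (ENNReal.ofReal q₁) (cubeVol d))
    tv (Or.inr (ENNReal.mul_lt_top (by simp) huf).ne))).add
    (ENNReal.Tendsto.mul_const (b := eLpNorm v (ENNReal.ofReal q₂) (cubeVol d)) tu (Or.inr hvf.ne))
  simp only [mul_zero, zero_mul, add_zero] at hlim
  refine tendsto_of_tendsto_of_tendsto_of_le_of_le' tendsto_const_nhds hlim
    (Filter.Eventually.of_forall fun _ => zero_le) ?_
  filter_upwards [Ioo_mem_nhdsGT (zero_lt_one' ℝ)] with ε hε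
  have mu := measurable_sMollify ε hu
  have mv := measurable_sMollify ε hv
  have muv := measurable_sMollify ε huv
  have heq : (fun x => sMollify ε (fun y => u y * v y) x - sMollify ε u x * sMollify ε v x)
      = ((fun x => sMollify ε (fun y => u y * v y) x - u x * v x)
        - (fun x => sMollify ε u x * (sMollify ε v x - v x)))
        - (fun x => (sMollify ε u x - u x) * v x) := by
    ext x
    simp only [Pi.sub_apply]
    ring
  have hq' : 1 ≤ ENNReal.ofReal q := by simpa using hq
  have m1 : Measurable (fun x => sMollify ε (fun y => u y * v y) x - u x * v x) := muv.sub huv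
  have m2 : Measurable (fun x => sMollify ε u x * (sMollify ε v x - v x)) := mu.mul (mv.sub hv)
  have m3 : Measurable (fun x => (sMollify ε u x - u x) * v x) := (mu.sub hu).mul hv
  rw [heq]
  refine (eLpNorm_sub_le (m1.sub m2).aestronglyMeasurable m3.aestronglyMeasurable hq').trans ?_
  refine add_le_add ((eLpNorm_sub_le m1.aestronglyMeasurable m2.aestronglyMeasurable hq').trans
    (add_le_add le_rfl ?_)) (holder_cube hq hq₁ hq₂ hqq (mu.sub hu) hv)
  refine (holder_cube hq hq₁ hq₂ hqq mu (mv.sub hv)).trans ?_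
  exact mul_le_mul' (eLpNorm_mollify_le hε.1 hε.2.le hu hup hq₁) le_rfl

/-- **Lemma 2.5**: for finite exponents with `1/p = 1/p₁ + 1/p₂`, `1/q = 1/q₁ + 1/q₂`,
`f ∈ L^{p₁}(0,T;L^{q₁}(𝕋^d))` and `g ∈ L^{p₂}(0,T;L^{q₂}(𝕋^d))`,
`‖(fg)^ε - f^ε g^ε‖_{L^p(0,T;L^q(𝕋^d))} → 0` as `ε → 0⁺`, the mollification being
taken in the space variable. -/
theorem product_commutator_tendsto_zero
    (d : ℕ) (hd : 2 ≤ d) (T : ℝ) (hT : 0 < T)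
    (p q p₁ q₁ p₂ q₂ : ℝ)
    (hp : 1 ≤ p) (hq : 1 ≤ q) (hp₁ : 1 ≤ p₁) (hq₁ : 1 ≤ q₁) (hp₂ : 1 ≤ p₂) (hq₂ : 1 ≤ q₂)
    (hpp : 1 / p = 1 / p₁ + 1 / p₂) (hqq : 1 / q = 1 / q₁ + 1 / q₂)
    (f g : ℝ → (Fin d → ℝ) → ℝ)
    (hfm : Measurable (Function.uncurry f)) (hgm : Measurable (Function.uncurry g))
    (hfper : ∀ t, SpacePeriodic (f t)) (hgper : ∀ t, SpacePeriodic (g t))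
    (hf : MemLpLq T (ENNReal.ofReal p₁) (ENNReal.ofReal q₁) f)
    (hg : MemLpLq T (ENNReal.ofReal p₂) (ENNReal.ofReal q₂) g) :
    Filter.Tendsto (fun ε : ℝ =>
        timeLpOn (Set.Ioo 0 T) (ENNReal.ofReal p) (fun t =>
          eLpNorm (fun x =>
            sMollify ε (fun y => f t y * g t y) x
              - sMollify ε (f t) x * sMollify ε (g t) x) (ENNReal.ofReal q) (cubeVol d)))
      (nhdsWithin 0 (Set.Ioi 0)) (nhds 0) := by
  have hp0 : 0 < p := by linarith
  have e0 : (ENNReal.ofReal p).toReal = p := ENNReal.toReal_ofReal hp0.le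
  have e1 : (ENNReal.ofReal p₁).toReal = p₁ := ENNReal.toReal_ofReal (by linarith)
  have e2 : (ENNReal.ofReal p₂).toReal = p₂ := ENNReal.toReal_ofReal (by linarith)
  have hlt : p < p₁ := by
    have h2 : 0 < 1 / p₂ := by positivity
    exact (one_div_lt_one_div (by linarith) hp0).1 (by linarith)
  simp only [MemLpLq, LpLqNorm, timeLpOn, ENNReal.ofReal_ne_top, if_false, e1, e2] at hf hg
  simp only [timeLpOn, ENNReal.ofReal_ne_top, if_false, e0]
  have hf' : ∫⁻ t in Set.Ioo 0 T, eLpNorm (f t) (ENNReal.ofReal q₁) (cubeVol d) ^ p₁ < ∞ :=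
    (ENNReal.rpow_lt_top_iff_of_pos (by positivity)).1 hf
  have hg' : ∫⁻ t in Set.Ioo 0 T, eLpNorm (g t) (ENNReal.ofReal q₂) (cubeVol d) ^ p₂ < ∞ :=
    (ENNReal.rpow_lt_top_iff_of_pos (by positivity)).1 hg
  have mA := measurable_eLpNorm_cube hq₁ hfm
  have mB := measurable_eLpNorm_cube hq₂ hgm
  set A : ℝ → ℝ≥0∞ := fun t => eLpNorm (f t) (ENNReal.ofReal q₁) (cubeVol d) with hA
  set B : ℝ → ℝ≥0∞ := fun t => eLpNorm (g t) (ENNReal.ofReal q₂) (cubeVol d) with hB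
  have hAae : ∀ᵐ t ∂(volume.restrict (Set.Ioo 0 T)), A t < ∞ := by
    filter_upwards [ae_lt_top (mA.pow_const p₁) hf'.ne] with t ht
    exact (ENNReal.rpow_lt_top_iff_of_pos (by linarith)).1 ht
  have hBae : ∀ᵐ t ∂(volume.restrict (Set.Ioo 0 T)), B t < ∞ := by
    filter_upwards [ae_lt_top (mB.pow_const p₂) hg'.ne] with t ht
    exact (ENNReal.rpow_lt_top_iff_of_pos (by linarith)).1 ht
  have hfg : Measurable (Function.uncurry fun t y => f t y * g t y) := hfm.mul hgm
  have hfs : ∀ t, Measurable (f t) := fun t => hfm.of_uncurry_left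
  have hgs : ∀ t, Measurable (g t) := fun t => hgm.of_uncurry_left
  have hAB : ∫⁻ t in Set.Ioo 0 T, (A t * B t) ^ p < ∞ := by
    have h := ENNReal.lintegral_Lp_mul_le_Lq_mul_Lr hp0 hlt hpp (volume.restrict (Set.Ioo 0 T))
      mA.aemeasurable mB.aemeasurable
    exact (ENNReal.rpow_lt_top_iff_of_pos (by positivity)).1
      (h.trans_lt (ENNReal.mul_lt_top hf hg))
  have hmain := tendsto_lintegral_filter_of_dominated_convergence
    (μ := volume.restrict (Set.Ioo 0 T)) (l := nhdsWithin (0:ℝ) (Set.Ioi 0))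
    (F := fun ε t => eLpNorm (fun x => sMollify ε (fun y => f t y * g t y) x
              - sMollify ε (f t) x * sMollify ε (g t) x) (ENNReal.ofReal q) (cubeVol d) ^ p)
    (f := fun _ => 0)
    (fun t => ((3 ^ d + 3 ^ d * 3 ^ d) * (A t * B t)) ^ p) ?_ ?_ ?_ ?_
  · rw [lintegral_zero] at hmain
    have h := (ENNReal.continuous_rpow_const (y := 1 / p)).tendsto 0
    rw [ENNReal.zero_rpow_of_pos (by positivity)] at h
    exact h.comp hmain
  · refine Filter.Eventually.of_forall fun ε => ?_
    refine (measurable_eLpNorm_cube hq ?_).pow_const p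
    exact (measurable_sMollify_uncurry ε hfg).sub
      ((measurable_sMollify_uncurry ε hfm).mul (measurable_sMollify_uncurry ε hgm))
  · filter_upwards [Ioo_mem_nhdsGT (zero_lt_one' ℝ)] with ε hε
    refine ae_of_all _ fun t => ENNReal.rpow_le_rpow ?_ hp0.le
    exact commutator_bound hq hq₁ hq₂ hqq (hfs t) (hgs t) (hfper t) (hgper t) hε.1 hε.2.le
  · simp_rw [ENNReal.mul_rpow_of_nonneg ((3 : ℝ≥0∞) ^ d + 3 ^ d * 3 ^ d) _ hp0.le]
    have mAB : Measurable fun t => (A t * B t) ^ p := (mA.mul mB).pow_const p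
    rw [lintegral_const_mul _ mAB]
    refine (ENNReal.mul_lt_top (ENNReal.rpow_lt_top_of_nonneg hp0.le ?_) hAB).ne
    exact ENNReal.add_ne_top.2 ⟨by simp, ENNReal.mul_ne_top (by simp) (by simp)⟩
  · filter_upwards [hAae, hBae] with t hat hbt
    have h1 := commutator_tendsto hq hq₁ hq₂ hqq (hfs t) (hgs t) (hfper t) (hgper t) hat hbt
    have h := (ENNReal.continuous_rpow_const (y := p)).tendsto 0
    rw [ENNReal.zero_rpow_of_pos hp0] at h
    exact h.comp h1

end CompressibleEuler
end
end
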